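/- arXiv:1703.06684 — 2 statements merged into one kernel-verified Lean document; each statement's English description precedes it below -/
import Mathlib

section
/- (Quenched central limit theorem) For almost every realization ξ of the random environment, under the quenched law P_ξ the rescaled centered walk t^{-1/2} Y_t = t^{-1/2}(X_t - t b) converges in distribution, as t → ∞, to a centered n-dimensional Gaussian vector with covariance matrix η², where (η²)_{ij} = Σ_{u∈ℤⁿ} (u_i − b_i)(u_j − b_j) P̄(u). -/
open MeasureTheory ProbabilityTheory Filter Topology

/-- The limiting covariance matrix `η²` with entries
`(η²)_{ij} = Σ_u (u_i − b_i)(u_j − b_j) P̄(u)`, where `P̄(u) = P₀(u) + Σ_s π(s) c(u,s)`. -/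
noncomputable def etaSq {n : ℕ} {S : Type} [Fintype S]
    (π : S → ℝ) (P₀ : (Fin n → ℤ) → ℝ) (c : (Fin n → ℤ) → S → ℝ)
    (b : Fin n → ℝ) (i j : Fin n) : ℝ :=
  ∑ᶠ u : Fin n → ℤ, ((u i : ℝ) - b i) * ((u j : ℝ) - b j) * (P₀ u + ∑ s : S, π s * c u s)

set_option linter.unusedSectionVars false

section core
variable {V : Type} [AddCommGroup V] [DecidableEq V] {S : Type}

noncomputable def Ew (q : V → S → ℝ) (U : Finset V) (x0 : V) (ξ : ℕ → V → S)
    {A : Type} [AddCommGroup A] [Module ℝ A] : ℕ → (V → A) → A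
  | 0, g => g x0
  | t + 1, g => Ew q U x0 ξ t (fun x => ∑ u ∈ U, q u (ξ t x) • g (x + u))

def Bx (U : Finset V) (x0 : V) : ℕ → Finset V
  | 0 => {x0}
  | t + 1 => (Bx U x0 t ×ˢ U).image (fun p => p.1 + p.2)

variable (q : V → S → ℝ) (U : Finset V) (x0 : V) (ξ : ℕ → V → S)

lemma Bx_succ {t : ℕ} {x u : V} (hx : x ∈ Bx U x0 t) (hu : u ∈ U) : x + u ∈ Bx U x0 (t+1) := by
  simp only [Bx, Finset.mem_image, Finset.mem_product]
  exact ⟨(x, u), ⟨hx, hu⟩, rfl⟩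

lemma Ew_congr {A : Type} [AddCommGroup A] [Module ℝ A] (ξ' : ℕ → V → S) (t : ℕ) :
    ∀ (g g' : V → A) (_ : ∀ x ∈ Bx U x0 t, g x = g' x)
    (_ : ∀ r < t, ∀ x ∈ Bx U x0 r, ξ r x = ξ' r x),
    Ew q U x0 ξ t g = Ew q U x0 ξ' t g' := by
  induction t with
  | zero => intro g g' h _; exact h _ (by simp [Bx])
  | succ t ih =>
    intro g g' h hξ
    simp only [Ew]
    apply ih
    · intro x hx
      apply Finset.sum_congr rfl
      intro u hu
      rw [h _ (Bx_succ U x0 hx hu), hξ t (by omega) x hx]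
    · intro r hr; exact hξ r (by omega)

lemma Ew_add {A : Type} [AddCommGroup A] [Module ℝ A] (t : ℕ) :
    ∀ (g g' : V → A), Ew q U x0 ξ t (fun x => g x + g' x) = Ew q U x0 ξ t g + Ew q U x0 ξ t g' := by
  induction t with
  | zero => intro g g'; rfl
  | succ t ih =>
    intro g g'
    simp only [Ew, smul_add, Finset.sum_add_distrib]
    exact ih _ _

lemma Ew_clm {A A' : Type} [AddCommGroup A] [Module ℝ A] [AddCommGroup A'] [Module ℝ A']
    (L : A →ₗ[ℝ] A') (t : ℕ) :
    ∀ (g : V → A), Ew q U x0 ξ t (fun x => L (g x)) = L (Ew q U x0 ξ t g) := by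
  induction t with
  | zero => intro g; rfl
  | succ t ih =>
    intro g
    simp only [Ew, ← ih, map_sum, map_smul]

lemma Ew_sum {A ι : Type} [AddCommGroup A] [Module ℝ A] (t : ℕ) (s : Finset ι) (g : ι → V → A) :
    Ew q U x0 ξ t (fun x => ∑ i ∈ s, g i x) = ∑ i ∈ s, Ew q U x0 ξ t (g i) := by
  classical
  induction s using Finset.induction_on with
  | empty =>
    have := Ew_clm q U x0 ξ (0 : A →ₗ[ℝ] A) t (fun _ => 0)
    simpa using this
  | insert i s hi ih =>
    simp only [Finset.sum_insert hi]
    rw [← ih]; exact Ew_add q U x0 ξ t _ _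

lemma Ew_repr {A : Type} [AddCommGroup A] [Module ℝ A] (t : ℕ) (g : V → A) :
    Ew q U x0 ξ t g = ∑ x ∈ Bx U x0 t, Ew q U x0 ξ t (fun y => if y = x then (1:ℝ) else 0) • g x := by
  have h : ∀ x, Ew q U x0 ξ t (fun y => if y = x then (1:ℝ) else 0) • g x
      = Ew q U x0 ξ t (fun y => (if y = x then (1:ℝ) else 0) • g x) := by
    intro x
    have := Ew_clm q U x0 ξ ((LinearMap.id : ℝ →ₗ[ℝ] ℝ).smulRight (g x)) t
      (fun y => if y = x then (1:ℝ) else 0)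
    simpa using this.symm
  simp_rw [h]
  rw [← Ew_sum]
  apply Ew_congr
  · intro x hx
    simp [hx]
  · intros; rfl

lemma Ew_mono (hq0 : ∀ u s, 0 ≤ q u s) (t : ℕ) : ∀ (g g' : V → ℝ), (∀ x, g x ≤ g' x) →
    Ew q U x0 ξ t g ≤ Ew q U x0 ξ t g' := by
  induction t with
  | zero => intro g g' h; exact h _
  | succ t ih =>
    intro g g' h
    apply ih
    intro x
    apply Finset.sum_le_sum
    intro u _
    exact mul_le_mul_of_nonneg_left (h _) (hq0 _ _)

lemma Ew_const (hq1 : ∀ s, ∑ u ∈ U, q u s = 1) {A : Type} [AddCommGroup A] [Module ℝ A] (t : ℕ) (a : A) :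
    Ew q U x0 ξ t (fun _ => a) = a := by
  induction t with
  | zero => rfl
  | succ t ih => simp only [Ew, ← Finset.sum_smul, hq1, one_smul, ih]

lemma Ew_norm (hq0 : ∀ u s, 0 ≤ q u s) {A : Type} [NormedAddCommGroup A] [NormedSpace ℝ A] (t : ℕ) : ∀ (g : V → A),
    ‖Ew q U x0 ξ t g‖ ≤ Ew q U x0 ξ t (fun x => ‖g x‖) := by
  induction t with
  | zero => intro g; exact le_rfl
  | succ t ih =>
    intro g
    refine (ih _).trans ?_
    simp only [Ew]
    apply Ew_mono q U x0 ξ hq0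
    intro x
    refine (norm_sum_le _ _).trans ?_
    apply Finset.sum_le_sum
    intro u _
    rw [norm_smul, Real.norm_of_nonneg (hq0 _ _), smul_eq_mul]

/-- second moment bound -/
lemma Ew_sq (ℓ : V → ℝ) (β C : ℝ) (hadd : ∀ x y, ℓ (x + y) = ℓ x + ℓ y)
    (hq0 : ∀ u s, 0 ≤ q u s) (hq1 : ∀ s, ∑ u ∈ U, q u s = 1)
    (hm : ∀ s, ∑ u ∈ U, q u s * (ℓ u - β) = 0)
    (hv : ∀ s, ∑ u ∈ U, q u s * (ℓ u - β)^2 ≤ C) (t : ℕ) :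
    Ew q U x0 ξ t (fun x => (ℓ x - t * β)^2) ≤ (ℓ x0)^2 + t * C := by
  induction t with
  | zero => simp [Ew]
  | succ t ih =>
    simp only [Ew]
    have : Ew q U x0 ξ t (fun x => ∑ u ∈ U, q u (ξ t x) • (ℓ (x+u) - ((t+1 : ℕ) : ℝ) * β)^2)
      ≤ Ew q U x0 ξ t (fun x => (ℓ x - t * β)^2 + C) := by
      apply Ew_mono q U x0 ξ hq0
      intro x
      have e : ∀ u, q u (ξ t x) • (ℓ (x+u) - ((t+1 : ℕ) : ℝ) * β)^2
        = q u (ξ t x) * (ℓ x - t * β)^2 + (2 * (ℓ x - t*β)) * (q u (ξ t x) * (ℓ u - β))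
          + q u (ξ t x) * (ℓ u - β)^2 := by
        intro u; rw [hadd, smul_eq_mul]; push_cast; ring
      simp only [e, Finset.sum_add_distrib, ← Finset.sum_mul, ← Finset.mul_sum, hm, hq1]
      linarith [hv (ξ t x)]
    refine this.trans ?_
    rw [Ew_add, Ew_const q U x0 ξ hq1]
    push_cast; linarith

end core


section conc
variable {V : Type} [AddCommGroup V] [DecidableEq V] {S : Type} [Fintype S]

noncomputable def extF (F : Finset (ℕ × V)) (s0 : S) (f : F → S) : ℕ → V → S :=
  fun t x => if h : (t, x) ∈ F then f ⟨(t, x), h⟩ else s0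

noncomputable def Ex (π : S → ℝ) (F : Finset (ℕ × V)) (s0 : S) (G : (ℕ → V → S) → ℝ) : ℝ :=
  ∑ f : F → S, (∏ p, π (f p)) * G (extF F s0 f)

variable (π : S → ℝ) (F : Finset (ℕ × V)) (s0 : S)

lemma Ex_one (hπ1 : ∑ s, π s = 1) : Ex π F s0 (fun _ => 1) = 1 := by
  classical
  simp only [Ex, mul_one]
  have := Fintype.prod_sum (fun (_ : F) (s : S) => π s)
  rw [← this]; simp [hπ1]

lemma Ex_mono (hπ0 : ∀ s, 0 ≤ π s) (G G' : (ℕ → V → S) → ℝ) (h : ∀ ξ, G ξ ≤ G' ξ) :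
    Ex π F s0 G ≤ Ex π F s0 G' := by
  apply Finset.sum_le_sum
  intro f _
  exact mul_le_mul_of_nonneg_left (h _) (Finset.prod_nonneg fun _ _ => hπ0 _)

lemma Ex_add (G G' : (ℕ → V → S) → ℝ) :
    Ex π F s0 (fun ξ => G ξ + G' ξ) = Ex π F s0 G + Ex π F s0 G' := by
  simp [Ex, mul_add, Finset.sum_add_distrib]

lemma Ex_mul (a : ℝ) (G : (ℕ → V → S) → ℝ) :
    Ex π F s0 (fun ξ => a * G ξ) = a * Ex π F s0 G := by
  simp only [Ex, Finset.mul_sum]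
  apply Finset.sum_congr rfl; intros; ring

lemma Ex_sum {ι : Type} (s : Finset ι) (G : ι → (ℕ → V → S) → ℝ) :
    Ex π F s0 (fun ξ => ∑ i ∈ s, G i ξ) = ∑ i ∈ s, Ex π F s0 (G i) := by
  simp only [Ex, Finset.mul_sum]
  exact Finset.sum_comm

lemma Ex_zero (t : ℕ) (x : V) (hp : (t, x) ∈ F) (G : (ℕ → V → S) → ℝ) (h : S → ℝ)
    (hh : ∑ s, π s * h s = 0)
    (hG : ∀ ξ ξ' : ℕ → V → S, (∀ r < t, ξ r = ξ' r) → G ξ = G ξ') :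
    Ex π F s0 (fun ξ => G ξ * h (ξ t x)) = 0 := by
  classical
  simp only [Ex]
  let p : F := ⟨(t, x), hp⟩
  rw [← (Equiv.funSplitAt p S).symm.sum_comp, Fintype.sum_prod_type, Finset.sum_comm]
  apply Finset.sum_eq_zero
  intro f' _
  have key : ∀ s : S, (∏ r, π ((Equiv.funSplitAt p S).symm (s, f') r)) *
      (G (extF F s0 ((Equiv.funSplitAt p S).symm (s, f'))) *
        h (extF F s0 ((Equiv.funSplitAt p S).symm (s, f')) t x))
      = ((∏ i, π (f' i)) * G (extF F s0 ((Equiv.funSplitAt p S).symm (s0, f')))) * (π s * h s) := by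
    intro s
    rw [Fintype.prod_eq_mul_prod_subtype_ne _ p]
    have e1 : (Equiv.funSplitAt p S).symm (s, f') p = s := by simp [Equiv.funSplitAt]
    have e2 : ∀ i : {i // i ≠ p}, (Equiv.funSplitAt p S).symm (s, f') i.1 = f' i := by
      intro i; simp [Equiv.funSplitAt, i.2]
    have e3 : extF F s0 ((Equiv.funSplitAt p S).symm (s, f')) t x = s := by
      simp only [extF, hp, dite_true]; exact e1
    have e4 : G (extF F s0 ((Equiv.funSplitAt p S).symm (s, f')))
        = G (extF F s0 ((Equiv.funSplitAt p S).symm (s0, f'))) := by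
      apply hG
      intro r hr
      funext y
      simp only [extF]
      split_ifs with hy
      · have : (⟨(r, y), hy⟩ : F) ≠ p := by
          intro e
          have := congrArg (fun z : F => z.1.1) e
          simp [p] at this; omega
        simp [Equiv.funSplitAt, this]
      · rfl
    rw [e1, e3, e4]
    simp only [e2]
    ring
  simp_rw [key]
  rw [← Finset.mul_sum, hh, mul_zero]

lemma exp_le_chord (l k d : ℝ) (hk : 0 < k) (hd : |d| ≤ k) :
    Real.exp (l * d) ≤ Real.cosh (l * k) + d * (Real.sinh (l * k) / k) := by
  have hd' := abs_le.1 hd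
  have h := convexOn_exp.2 (Set.mem_univ (-(l*k))) (Set.mem_univ (l*k))
    (show 0 ≤ (k - d) / (2*k) from div_nonneg (by linarith) (by linarith))
    (show 0 ≤ (k + d) / (2*k) from div_nonneg (by linarith) (by linarith)) (by field_simp; ring)
  simp only [smul_eq_mul] at h
  have e1 : (k - d) / (2*k) * (-(l*k)) + (k + d) / (2*k) * (l*k) = l * d := by field_simp; ring
  rw [e1] at h
  refine h.trans (le_of_eq ?_)
  rw [Real.cosh_eq, Real.sinh_eq]
  field_simp; ring

/-- Measure of a cylinder event is bounded by finite expectation. -/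
lemma cyl_le [MeasurableSpace S] (hπ0 : ∀ s, 0 ≤ π s) (Penv : Measure (ℕ → V → S))
    (hiid : ∀ (F : Finset (ℕ × V)) (f : ℕ × V → S),
      Penv {ξ | ∀ p ∈ F, ξ p.1 p.2 = f p} = ∏ p ∈ F, ENNReal.ofReal (π (f p)))
    (Q : (ℕ → V → S) → Prop) (G : (ℕ → V → S) → ℝ)
    (hQ : ∀ ξ ξ' : ℕ → V → S, (∀ p ∈ F, ξ p.1 p.2 = ξ' p.1 p.2) → Q ξ → Q ξ')
    (hG0 : ∀ ξ, 0 ≤ G ξ) (hG : ∀ ξ, Q ξ → 1 ≤ G ξ) :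
    Penv {ξ | Q ξ} ≤ ENNReal.ofReal (Ex π F s0 G) := by
  classical
  have hsub : {ξ | Q ξ} ⊆ ⋃ f ∈ (Finset.univ.filter fun f : F → S => Q (extF F s0 f)),
      {ξ : ℕ → V → S | ∀ p ∈ F, ξ p.1 p.2 = (fun p : ℕ × V => extF F s0 f p.1 p.2) p} := by
    intro ξ hξ
    simp only [Set.mem_iUnion, Finset.mem_filter, Finset.mem_univ, true_and]
    have e : ∀ p ∈ F, ξ p.1 p.2 = extF F s0 (fun p : F => ξ p.1.1 p.1.2) p.1 p.2 := by
      intro p hp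
      simp [extF, hp]
    exact ⟨_, hQ _ _ e hξ, e⟩
  refine (measure_mono hsub).trans ((measure_biUnion_finset_le _ _).trans ?_)
  simp_rw [hiid]
  have hw : ∀ f : F → S, ∏ p ∈ F, ENNReal.ofReal (π (extF F s0 f p.1 p.2))
      = ENNReal.ofReal (∏ p, π (f p)) := by
    intro f
    rw [ENNReal.ofReal_prod_of_nonneg (fun _ _ => hπ0 _), ← Finset.prod_coe_sort]
    apply Finset.prod_congr rfl
    intro p _
    simp [extF]
  simp_rw [hw]
  rw [← ENNReal.ofReal_sum_of_nonneg (fun f _ => Finset.prod_nonneg fun _ _ => hπ0 _)]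
  apply ENNReal.ofReal_le_ofReal
  simp only [Ex]
  rw [Finset.sum_filter]
  apply Finset.sum_le_sum
  intro f _
  have h0 : 0 ≤ ∏ p, π (f p) := Finset.prod_nonneg fun _ _ => hπ0 _
  split_ifs with h
  · exact le_mul_of_one_le_right h0 (hG _ h)
  · exact mul_nonneg h0 (hG0 _)

variable (q : V → S → ℝ) (U : Finset V) (x0 : V)

lemma mgf_bound (hπ0 : ∀ s, 0 ≤ π s) (hπ1 : ∑ s, π s = 1)
    (hq0 : ∀ u s, 0 ≤ q u s) (hq1 : ∀ s, ∑ u ∈ U, q u s = 1)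
    (e : ℕ → V → ℂ) (he : ∀ t x, ‖e t x‖ ≤ 1) (φ : ℂ) (hφ : ‖φ‖ ≤ 1) (ch : S → ℂ) (κ : ℝ)
    (hκ : 0 < κ) (hch : ∀ s, ‖ch s‖ ≤ κ) (hch0 : ∑ s, (π s : ℂ) * ch s = 0)
    (hstep : ∀ t x s, ∑ u ∈ U, q u s • e (t+1) (x+u) = e t x * (φ + ch s))
    (z : ℂ) (hz : ‖z‖ ≤ 1) (l : ℝ) (T : ℕ)
    (hF : ∀ r < T, ∀ x ∈ Bx U x0 r, (r, x) ∈ F) (t : ℕ) (ht : t ≤ T) :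
    Ex π F s0 (fun ξ => Real.exp (l * (z * (φ ^ (T - t) * Ew q U x0 ξ t (e t) - φ ^ T * e 0 x0)).re))
      ≤ Real.cosh (l * κ) ^ t := by
  induction t with
  | zero => simp [Ew, Ex_one π F s0 hπ1]
  | succ t ih =>
    specialize ih (by omega)
    set M : (ℕ → V → S) → ℝ :=
      fun ξ => (z * (φ ^ (T - t) * Ew q U x0 ξ t (e t) - φ ^ T * e 0 x0)).re with hM
    set D : (ℕ → V → S) → ℝ := fun ξ => (z * φ ^ (T - (t+1)) *
      Ew q U x0 ξ t (fun x => e t x * ch (ξ t x))).re with hD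
    have hdec : ∀ ξ, (z * (φ ^ (T - (t+1)) * Ew q U x0 ξ (t+1) (e (t+1)) - φ ^ T * e 0 x0)).re
        = M ξ + D ξ := by
      intro ξ
      have h1 : Ew q U x0 ξ (t+1) (e (t+1)) = φ * Ew q U x0 ξ t (e t) +
          Ew q U x0 ξ t (fun x => e t x * ch (ξ t x)) := by
        simp only [Ew, hstep]
        have h2 := Ew_clm q U x0 ξ (LinearMap.mulLeft ℝ φ) t (e t)
        simp only [LinearMap.mulLeft_apply] at h2
        rw [← h2, ← Ew_add]
        congr 1; funext x; ring
      have h3 : φ ^ (T - t) = φ ^ (T - (t+1)) * φ := by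
        rw [← pow_succ]; congr 1; omega
      rw [h1, hM, hD]
      simp only
      rw [h3, ← Complex.add_re]
      congr 1; ring
    have hDb : ∀ ξ, |D ξ| ≤ κ := by
      intro ξ
      refine (Complex.abs_re_le_norm _).trans ?_
      rw [norm_mul, norm_mul, norm_pow]
      have h1 : ‖Ew q U x0 ξ t (fun x => e t x * ch (ξ t x))‖ ≤ κ := by
        refine (Ew_norm q U x0 ξ hq0 t _).trans ?_
        refine (Ew_mono q U x0 ξ hq0 t _ (fun _ => κ) ?_).trans (Ew_const q U x0 ξ hq1 t κ).le
        intro x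
        rw [norm_mul]
        calc _ ≤ 1 * κ := mul_le_mul (he _ _) (hch _) (norm_nonneg _) zero_le_one
          _ = κ := one_mul _
      have h2 : ‖φ‖ ^ (T - (t+1)) ≤ 1 := pow_le_one₀ (norm_nonneg _) hφ
      calc _ ≤ 1 * 1 * κ := by gcongr
        _ = κ := by ring
    have hle : ∀ ξ, Real.exp (l * (z * (φ ^ (T - (t+1)) * Ew q U x0 ξ (t+1) (e (t+1))
          - φ ^ T * e 0 x0)).re)
        ≤ Real.cosh (l*κ) * Real.exp (l * M ξ)
          + (Real.sinh (l*κ) / κ) * (Real.exp (l * M ξ) * D ξ) := by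
      intro ξ
      rw [hdec, mul_add, Real.exp_add]
      have := mul_le_mul_of_nonneg_left (exp_le_chord l κ (D ξ) hκ (hDb ξ))
        (Real.exp_pos (l * M ξ)).le
      refine this.trans (le_of_eq (by ring))
    refine (Ex_mono π F s0 hπ0 _ _ hle).trans ?_
    rw [Ex_add, Ex_mul, Ex_mul]
    have hz0 : Ex π F s0 (fun ξ => Real.exp (l * M ξ) * D ξ) = 0 := by
      have hrep : ∀ ξ, Real.exp (l * M ξ) * D ξ = ∑ x ∈ Bx U x0 t,
          (Real.exp (l * M ξ) * Ew q U x0 ξ t (fun y => if y = x then (1:ℝ) else 0)) *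
            (fun s => (z * φ ^ (T - (t+1)) * (e t x * ch s)).re) (ξ t x) := by
        intro ξ
        simp only [hD]
        rw [Ew_repr, Finset.mul_sum, Complex.re_sum, Finset.mul_sum]
        apply Finset.sum_congr rfl
        intro x _
        rw [mul_assoc (Real.exp _)]
        congr 1
        rw [mul_smul_comm, Complex.smul_re, smul_eq_mul]
      simp_rw [hrep]
      rw [Ex_sum]
      apply Finset.sum_eq_zero
      intro x hx
      apply Ex_zero π F s0 t x (hF t (by omega) x hx)
        (fun ξ => Real.exp (l * M ξ) * Ew q U x0 ξ t (fun y => if y = x then (1:ℝ) else 0))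
        (fun s => (z * φ ^ (T - (t+1)) * (e t x * ch s)).re)
      · have : ∑ s, π s * (z * φ ^ (T - (t+1)) * (e t x * ch s)).re
            = (z * φ ^ (T - (t+1)) * e t x * ∑ s, (π s : ℂ) * ch s).re := by
          rw [Finset.mul_sum, Complex.re_sum]
          apply Finset.sum_congr rfl
          intro s _
          rw [← Complex.re_ofReal_mul]
          congr 1; ring
        rw [this, hch0]; simp
      · intro ξ ξ' hξ
        have h1 : M ξ = M ξ' := by
          simp only [hM]
          rw [Ew_congr q U x0 ξ ξ' t (e t) (e t) (fun _ _ => rfl) (fun r hr x _ => by rw [hξ r hr])]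
        rw [h1, Ew_congr q U x0 ξ ξ' t _ _ (fun _ _ => rfl) (fun r hr x _ => by rw [hξ r hr])]
    rw [hz0, mul_zero, add_zero, pow_succ, mul_comm]
    exact mul_le_mul_of_nonneg_right ih (Real.cosh_pos _).le

lemma conc_bound [MeasurableSpace S] (hπ0 : ∀ s, 0 ≤ π s) (hπ1 : ∑ s, π s = 1)
    (Penv : Measure (ℕ → V → S))
    (hiid : ∀ (F : Finset (ℕ × V)) (f : ℕ × V → S),
      Penv {ξ | ∀ p ∈ F, ξ p.1 p.2 = f p} = ∏ p ∈ F, ENNReal.ofReal (π (f p)))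
    (hq0 : ∀ u s, 0 ≤ q u s) (hq1 : ∀ s, ∑ u ∈ U, q u s = 1)
    (e : ℕ → V → ℂ) (he : ∀ t x, ‖e t x‖ ≤ 1) (φ : ℂ) (hφ : ‖φ‖ ≤ 1) (ch : S → ℂ) (K : ℝ)
    (hK : 0 < K) (T : ℕ) (hT : 1 ≤ T)
    (hch : ∀ s, ‖ch s‖ ≤ K / T) (hch0 : ∑ s, (π s : ℂ) * ch s = 0)
    (hstep : ∀ t x s, ∑ u ∈ U, q u s • e (t+1) (x+u) = e t x * (φ + ch s))
    (z : ℂ) (hz : ‖z‖ ≤ 1) (ε : ℝ) (hε : 0 < ε) :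
    Penv {ξ | ε ≤ (z * (Ew q U x0 ξ T (e T) - φ ^ T * e 0 x0)).re}
      ≤ ENNReal.ofReal (Real.exp (-(ε^2 / (2 * K^2))) ^ T) := by
  classical
  have hT0 : (0:ℝ) < T := by exact_mod_cast hT
  let F : Finset (ℕ × V) := (Finset.range T).biUnion fun r => (Bx U x0 r).image fun x => (r, x)
  have hF : ∀ r < T, ∀ x ∈ Bx U x0 r, (r, x) ∈ F := by
    intro r hr x hx
    simp only [F, Finset.mem_biUnion, Finset.mem_range, Finset.mem_image]
    exact ⟨r, hr, x, hx, rfl⟩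
  obtain ⟨s0⟩ : Nonempty S := by
    by_contra h
    rw [not_nonempty_iff] at h
    simp at hπ1
  set l : ℝ := ε * T / K^2 with hl
  have hl0 : 0 < l := by positivity
  have h1 := cyl_le π F s0 hπ0 Penv hiid
    (fun ξ => ε ≤ (z * (Ew q U x0 ξ T (e T) - φ ^ T * e 0 x0)).re)
    (fun ξ => Real.exp (-(l*ε)) *
      Real.exp (l * (z * (φ ^ (T - T) * Ew q U x0 ξ T (e T) - φ ^ T * e 0 x0)).re)) ?_ ?_ ?_
  · refine h1.trans (ENNReal.ofReal_le_ofReal ?_)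
    rw [Ex_mul]
    have h2 := mgf_bound π F s0 q U x0 hπ0 hπ1 hq0 hq1 e he φ hφ ch (K/T) (by positivity) hch hch0
      hstep z hz l T hF T le_rfl
    have h3 : Real.cosh (l * (K/T)) ^ T ≤ Real.exp ((l*(K/T))^2/2) ^ T :=
      pow_le_pow_left₀ (Real.cosh_pos _).le (Real.cosh_le_exp_half_sq _) _
    refine (mul_le_mul_of_nonneg_left (h2.trans h3) (Real.exp_pos _).le).trans (le_of_eq ?_)
    rw [← Real.exp_nat_mul, ← Real.exp_nat_mul, ← Real.exp_add]
    congr 1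
    rw [hl]
    field_simp
    ring
  · intro ξ ξ' hξ h
    rwa [Ew_congr q U x0 ξ ξ' T (e T) (e T) (fun _ _ => rfl)
      (fun r hr x hx => hξ _ (hF r hr x hx))] at h
  · intro ξ; positivity
  · intro ξ h
    rw [← Real.exp_add]
    apply Real.one_le_exp
    simp only [Nat.sub_self, pow_zero, one_mul]
    nlinarith
end conc


section link
variable {V : Type} [AddCommGroup V] [DecidableEq V] [Countable V] [MeasurableSpace V]
  [MeasurableSingletonClass V] {S : Type} {Ω : Type} [MeasurableSpace Ω]

lemma link_stepA (μ : Measure Ω) [IsProbabilityMeasure μ] (X : ℕ → Ω → V) (hX : ∀ t, Measurable (X t))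
    (q : V → S → ℝ) (U : Finset V) (ξ : ℕ → V → S) (hq0 : ∀ u s, 0 ≤ q u s)
    (hqU : ∀ u s, u ∉ U → q u s = 0) (t : ℕ) (xs : ℕ → V)
    (hM : ∀ (y : V), μ {ω | (∀ r ≤ t, X r ω = xs r) ∧ X (t + 1) ω = y}
        = ENNReal.ofReal (q (y - xs t) (ξ t (xs t))) * μ {ω | ∀ r ≤ t, X r ω = xs r})
    (g : V → ℂ) (C : ℝ) (hg : ∀ x, ‖g x‖ ≤ C) :
    ∫ ω in {ω | ∀ r ≤ t, X r ω = xs r}, g (X (t+1) ω) ∂μ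
     = ∫ ω in {ω | ∀ r ≤ t, X r ω = xs r}, ∑ u ∈ U, q u (ξ t (X t ω)) • g (X t ω + u) ∂μ := by
  set A := {ω | ∀ r ≤ t, X r ω = xs r} with hA
  have hAm : MeasurableSet A := by
    have : A = ⋂ r, ⋂ (_ : r ≤ t), X r ⁻¹' {xs r} := by ext ω; simp [hA]
    rw [this]
    exact MeasurableSet.iInter fun r => MeasurableSet.iInter fun _ => hX r (measurableSet_singleton _)
  have hR : ∫ ω in A, ∑ u ∈ U, q u (ξ t (X t ω)) • g (X t ω + u) ∂μ
      = μ.real A • ∑ u ∈ U, q u (ξ t (xs t)) • g (xs t + u) := by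
    rw [← setIntegral_const]
    apply setIntegral_congr_fun hAm
    intro ω hω
    simp only [hω t le_rfl]
  rw [hR]
  have hi : Integrable (fun ω => g (X (t+1) ω)) μ := by
    refine Integrable.of_bound (C := C) ?_ (ae_of_all _ fun ω => hg _)
    exact ((measurable_of_countable g).comp (hX _)).aestronglyMeasurable
  have hU : (⋃ y : V, A ∩ X (t+1) ⁻¹' {y}) = A := by
    ext ω; simp
  have hsum := hasSum_integral_iUnion (μ := μ) (f := fun ω => g (X (t+1) ω))
    (s := fun y : V => A ∩ X (t+1) ⁻¹' {y})
    (fun y => hAm.inter (hX _ (measurableSet_singleton _)))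
    (by
      intro y y' hy
      rw [Function.onFun, Set.disjoint_left]
      rintro ω ⟨_, h1⟩ ⟨_, h2⟩
      exact hy (by simp at h1 h2; rw [← h1, ← h2])) hi.integrableOn
  rw [hU] at hsum
  have hterm : ∀ y, ∫ ω in A ∩ X (t+1) ⁻¹' {y}, g (X (t+1) ω) ∂μ
      = (q (y - xs t) (ξ t (xs t)) * μ.real A) • g y := by
    intro y
    have h1 : ∫ ω in A ∩ X (t+1) ⁻¹' {y}, g (X (t+1) ω) ∂μ
      = ∫ ω in A ∩ X (t+1) ⁻¹' {y}, g y ∂μ := by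
      apply setIntegral_congr_fun (hAm.inter (hX _ (measurableSet_singleton _)))
      rintro ω ⟨_, h⟩
      simp at h
      simp only [h]
    rw [h1, setIntegral_const]
    congr 1
    have h2 := hM y
    have h3 : A ∩ X (t+1) ⁻¹' {y} = {ω | (∀ r ≤ t, X r ω = xs r) ∧ X (t + 1) ω = y} := by
      ext ω; simp [hA]
    rw [measureReal_def, h3, h2, ENNReal.toReal_mul, ENNReal.toReal_ofReal (hq0 _ _)]
    rfl
  simp_rw [hterm] at hsum
  have hsum2 := hasSum_sum_of_ne_finset_zero (L := SummationFilter.unconditional V) (s := U.image (fun u => xs t + u))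
    (f := fun y => (q (y - xs t) (ξ t (xs t)) * μ.real A) • g y) (by
      intro y hy
      rw [hqU, zero_mul, zero_smul]
      intro h
      apply hy
      exact Finset.mem_image.2 ⟨_, h, by abel⟩)
  rw [hsum.unique hsum2, Finset.sum_image (by intro a _ b _ h; simpa using h), Finset.smul_sum]
  apply Finset.sum_congr rfl
  intro u _
  rw [smul_smul, add_sub_cancel_left, mul_comm]

lemma link_step (μ : Measure Ω) [IsProbabilityMeasure μ] (X : ℕ → Ω → V) (hX : ∀ t, Measurable (X t))
    (q : V → S → ℝ) (U : Finset V) (ξ : ℕ → V → S) (hq0 : ∀ u s, 0 ≤ q u s)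
    (hq1 : ∀ s, ∑ u ∈ U, q u s = 1)
    (hqU : ∀ u s, u ∉ U → q u s = 0) (t : ℕ) (x0 : V)
    (hM : ∀ (xs : ℕ → V) (y : V), μ {ω | (∀ r ≤ t, X r ω = xs r) ∧ X (t + 1) ω = y}
        = ENNReal.ofReal (q (y - xs t) (ξ t (xs t))) * μ {ω | ∀ r ≤ t, X r ω = xs r})
    (g : V → ℂ) (C : ℝ) (hg : ∀ x, ‖g x‖ ≤ C) :
    ∫ ω in {ω | X 0 ω = x0}, g (X (t+1) ω) ∂μ
     = ∫ ω in {ω | X 0 ω = x0}, ∑ u ∈ U, q u (ξ t (X t ω)) • g (X t ω + u) ∂μ := by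
  have hg' : ∀ x, ‖∑ u ∈ U, q u (ξ t x) • g (x + u)‖ ≤ C := by
    intro x
    refine (norm_sum_le _ _).trans ?_
    calc _ ≤ ∑ u ∈ U, q u (ξ t x) * C := by
          apply Finset.sum_le_sum
          intro u _
          rw [norm_smul, Real.norm_of_nonneg (hq0 _ _)]
          exact mul_le_mul_of_nonneg_left (hg _) (hq0 _ _)
      _ = C := by rw [← Finset.sum_mul, hq1, one_mul]
  have hi : ∀ (k : ℕ) (g : V → ℂ), (∀ x, ‖g x‖ ≤ C) → Integrable (fun ω => g (X k ω)) μ := by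
    intro k g hg
    refine Integrable.of_bound (C := C) ?_ (ae_of_all _ fun ω => hg _)
    exact ((measurable_of_countable g).comp (hX _)).aestronglyMeasurable
  let xt : (Fin (t+1) → V) → ℕ → V := fun h r => if hr : r < t+1 then h ⟨r, hr⟩ else 0
  let s : (Fin (t+1) → V) → Set Ω := fun h => {ω | X 0 ω = x0} ∩ {ω | ∀ r ≤ t, X r ω = xt h r}
  have hAm : ∀ h, MeasurableSet {ω | ∀ r ≤ t, X r ω = xt h r} := by
    intro h
    have : {ω | ∀ r ≤ t, X r ω = xt h r} = ⋂ r, ⋂ (_ : r ≤ t), X r ⁻¹' {xt h r} := by ext ω; simp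
    rw [this]
    exact MeasurableSet.iInter fun r => MeasurableSet.iInter fun _ => hX r (measurableSet_singleton _)
  have hsm : ∀ h, MeasurableSet (s h) := fun h =>
    (hX 0 (measurableSet_singleton x0)).inter (hAm h)
  have hU : (⋃ h, s h) = {ω | X 0 ω = x0} := by
    ext ω
    simp only [s, Set.mem_iUnion, Set.mem_inter_iff, Set.mem_ofPred_eq, exists_and_left,
      and_iff_left_iff_imp]
    intro _
    refine ⟨fun r => X r ω, ?_⟩
    intro r hr
    simp [xt]; omega
  have hd : Pairwise (Function.onFun Disjoint s) := by
    intro h h' hne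
    rw [Function.onFun, Set.disjoint_left]
    rintro ω ⟨_, h1⟩ ⟨_, h2⟩
    apply hne
    funext r
    have a := h1 r (by omega)
    have b := h2 r (by omega)
    rw [a] at b
    have hr : (r : ℕ) ≤ t := by omega
    simpa [xt, hr] using b
  have S1 := hasSum_integral_iUnion (μ := μ) (f := fun ω => g (X (t+1) ω)) hsm hd
    (hi _ g hg).integrableOn
  have S2 := hasSum_integral_iUnion (μ := μ)
    (f := fun ω => ∑ u ∈ U, q u (ξ t (X t ω)) • g (X t ω + u)) hsm hd
    (hi t (fun x => ∑ u ∈ U, q u (ξ t x) • g (x + u)) hg').integrableOn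
  rw [hU] at S1 S2
  refine S1.unique ?_
  convert S2 using 1
  funext h
  by_cases hh : xt h 0 = x0
  · have : s h = {ω | ∀ r ≤ t, X r ω = xt h r} := by
      apply Set.inter_eq_right.2
      intro ω hω
      exact (hω 0 (Nat.zero_le _)).trans hh
    rw [this]
    exact link_stepA μ X hX q U ξ hq0 hqU t (xt h) (hM _) g C hg
  · have : s h = ∅ := by
      ext ω
      simp only [s, Set.mem_inter_iff, Set.mem_ofPred_eq, Set.mem_empty_iff_false, iff_false, not_and]
      intro h1 h2
      exact hh ((h2 0 (Nat.zero_le _)).symm.trans h1)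
    simp [this]

lemma link (μ : Measure Ω) [IsProbabilityMeasure μ] (X : ℕ → Ω → V) (hX : ∀ t, Measurable (X t))
    (q : V → S → ℝ) (U : Finset V) (ξ : ℕ → V → S) (hq0 : ∀ u s, 0 ≤ q u s)
    (hq1 : ∀ s, ∑ u ∈ U, q u s = 1)
    (hqU : ∀ u s, u ∉ U → q u s = 0) (x0 : V)
    (hM : ∀ t (xs : ℕ → V) (y : V), μ {ω | (∀ r ≤ t, X r ω = xs r) ∧ X (t + 1) ω = y}
        = ENNReal.ofReal (q (y - xs t) (ξ t (xs t))) * μ {ω | ∀ r ≤ t, X r ω = xs r})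
    (C : ℝ) (t : ℕ) : ∀ (g : V → ℂ) (_ : ∀ x, ‖g x‖ ≤ C),
    ∫ ω in {ω | X 0 ω = x0}, g (X t ω) ∂μ = μ.real {ω | X 0 ω = x0} • Ew q U x0 ξ t g := by
  induction t with
  | zero =>
    intro g hg
    rw [Ew, ← setIntegral_const]
    apply setIntegral_congr_fun (hX 0 (measurableSet_singleton x0))
    intro ω hω
    have : X 0 ω = x0 := hω
    simp only [this]
  | succ t ih =>
    intro g hg
    rw [link_step μ X hX q U ξ hq0 hq1 hqU t x0 (hM t) g C hg]
    have hg' : ∀ x, ‖∑ u ∈ U, q u (ξ t x) • g (x + u)‖ ≤ C := by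
      intro x
      refine (norm_sum_le _ _).trans ?_
      calc _ ≤ ∑ u ∈ U, q u (ξ t x) * C := by
            apply Finset.sum_le_sum
            intro u _
            rw [norm_smul, Real.norm_of_nonneg (hq0 _ _)]
            exact mul_le_mul_of_nonneg_left (hg _) (hq0 _ _)
        _ = C := by rw [← Finset.sum_mul, hq1, one_mul]
    exact ih (fun x => ∑ u ∈ U, q u (ξ t x) • g (x + u)) hg'

/-- Mixture over the starting point. -/
lemma link_tendsto (μ : Measure Ω) [IsProbabilityMeasure μ] (X : ℕ → Ω → V)
    (hX : ∀ t, Measurable (X t))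
    (q : V → S → ℝ) (U : Finset V) (ξ : ℕ → V → S) (hq0 : ∀ u s, 0 ≤ q u s)
    (hq1 : ∀ s, ∑ u ∈ U, q u s = 1)
    (hqU : ∀ u s, u ∉ U → q u s = 0)
    (hM : ∀ t (xs : ℕ → V) (y : V), μ {ω | (∀ r ≤ t, X r ω = xs r) ∧ X (t + 1) ω = y}
        = ENNReal.ofReal (q (y - xs t) (ξ t (xs t))) * μ {ω | ∀ r ≤ t, X r ω = xs r})
    (g : ℕ → V → ℂ) (hg : ∀ t x, ‖g t x‖ ≤ 1) (L : ℂ)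
    (hL : ∀ x0, Tendsto (fun t => Ew q U x0 ξ t (g t)) atTop (𝓝 L)) :
    Tendsto (fun t => ∫ ω, g t (X t ω) ∂μ) atTop (𝓝 L) := by
  have hU : (⋃ x0 : V, {ω | X 0 ω = x0}) = Set.univ := by ext ω; simp
  have hsm : ∀ x0 : V, MeasurableSet {ω | X 0 ω = x0} := fun x0 => hX 0 (measurableSet_singleton x0)
  have hd : Pairwise (Function.onFun Disjoint fun x0 : V => {ω | X 0 ω = x0}) := by
    intro h h' hne
    rw [Function.onFun, Set.disjoint_left]
    intro ω h1 h2
    exact hne (h1.symm.trans h2)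
  have hs : ∀ f : Ω → ℂ, Integrable f μ →
      HasSum (fun x0 => ∫ ω in {ω | X 0 ω = x0}, f ω ∂μ) (∫ ω, f ω ∂μ) := by
    intro f hf
    have := hasSum_integral_iUnion (μ := μ) (f := f) hsm hd hf.integrableOn
    rwa [hU, setIntegral_univ] at this
  have hone := hs (fun _ => (1:ℂ)) (integrable_const _)
  simp only [setIntegral_const, integral_const, probReal_univ] at hone
  have hsb : Summable fun x0 : V => μ.real {ω | X 0 ω = x0} := by
    have := hone.summable.norm
    simpa [abs_of_nonneg measureReal_nonneg] using this
  have e1 : ∀ t, ∫ ω, g t (X t ω) ∂μ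
      = ∑' x0, μ.real {ω | X 0 ω = x0} • Ew q U x0 ξ t (g t) := by
    intro t
    have hi : Integrable (fun ω => g t (X t ω)) μ := by
      refine Integrable.of_bound (C := 1) ?_ (ae_of_all _ fun ω => hg t _)
      exact ((measurable_of_countable (g t)).comp (hX _)).aestronglyMeasurable
    rw [← (hs _ hi).tsum_eq]
    congr 1
    funext x0
    exact link μ X hX q U ξ hq0 hq1 hqU x0 hM 1 t (g t) (hg t)
  have e2 : L = ∑' x0, μ.real {ω | X 0 ω = x0} • L := by
    have := (hone.mul_right L).tsum_eq
    simpa using this.symm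
  simp_rw [e1]
  rw [e2]
  apply tendsto_tsum_of_dominated_convergence hsb
  · intro x0
    exact (hL x0).const_smul _
  · refine Eventually.of_forall fun t x0 => ?_
    rw [norm_smul, Real.norm_of_nonneg measureReal_nonneg]
    refine mul_le_of_le_one_right measureReal_nonneg ?_
    refine (Ew_norm q U x0 ξ hq0 t _).trans ?_
    exact (Ew_mono q U x0 ξ hq0 t _ (fun _ => 1) (hg t)).trans (Ew_const q U x0 ξ hq1 t 1).le
end link


section clt
variable {V : Type} [AddCommGroup V] [DecidableEq V] {S : Type} [Fintype S]

noncomputable def eT (ℓ : V → ℝ) (β : ℝ) (T : ℕ) (t : ℕ) (x : V) : ℂ :=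
  Complex.exp (((ℓ x - t * β) / √T : ℝ) * Complex.I)

noncomputable def wT (ℓ : V → ℝ) (β : ℝ) (U : Finset V) (p : V → ℝ) (T : ℕ) : ℂ :=
  ∑ u ∈ U, (p u : ℂ) * Complex.exp (((ℓ u - β) / √T : ℝ) * Complex.I)

lemma norm_eT (ℓ : V → ℝ) (β : ℝ) (T t : ℕ) (x : V) : ‖eT ℓ β T t x‖ = 1 := by
  simp only [eT]; exact Complex.norm_exp_ofReal_mul_I _

lemma exp2 (a : ℝ) : ‖Complex.exp (a * Complex.I) - (1 + a * Complex.I)‖ ≤ a^2 * Real.exp |a| := by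
  have := Complex.norm_exp_sub_sum_le_norm_mul_exp (a * Complex.I) 2
  simpa [Finset.sum_range_succ] using this

lemma exp3 (a : ℝ) : ‖Complex.exp (a * Complex.I) - (1 + a * Complex.I - a^2/2)‖
    ≤ |a|^3 * Real.exp |a| := by
  have := Complex.norm_exp_sub_sum_le_norm_mul_exp (a * Complex.I) 3
  simpa [Finset.sum_range_succ, mul_pow, neg_div, ← sub_eq_add_neg] using this

lemma wT_bound (ℓ : V → ℝ) (β : ℝ) (U : Finset V) (p : V → ℝ) (T : ℕ) (hT : 1 ≤ T)
    (h0 : ∑ u ∈ U, p u = 0) (h1 : ∑ u ∈ U, p u * (ℓ u - β) = 0) :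
    ‖wT ℓ β U p T‖ ≤ (∑ u ∈ U, |p u| * ((ℓ u - β)^2 * Real.exp |ℓ u - β|)) / T := by
  have hT0 : (1:ℝ) ≤ T := by exact_mod_cast hT
  have hs : 1 ≤ √(T:ℝ) := Real.one_le_sqrt.2 hT0
  have e : wT ℓ β U p T = ∑ u ∈ U, (p u : ℂ) *
      (Complex.exp (((ℓ u - β) / √T : ℝ) * Complex.I) - (1 + ((ℓ u - β) / √T : ℝ) * Complex.I)) := by
    have h0' : ∑ u ∈ U, (p u : ℂ) = 0 := by exact_mod_cast h0
    have h1' : ∑ u ∈ U, (p u : ℂ) * ((ℓ u : ℂ) - β) = 0 := by exact_mod_cast h1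
    have : ∑ u ∈ U, (p u : ℂ) * (1 + ((ℓ u - β) / √T : ℝ) * Complex.I) = 0 := by
      have : ∀ u, (p u : ℂ) * (1 + ((ℓ u - β) / √T : ℝ) * Complex.I)
        = p u + (p u : ℂ) * ((ℓ u : ℂ) - β) * (Complex.I / (√T : ℝ)) := by
        intro u; push_cast; ring
      simp_rw [this]
      rw [Finset.sum_add_distrib, ← Finset.sum_mul, h0', h1']; simp
    simp_rw [mul_sub]
    rw [Finset.sum_sub_distrib, this, sub_zero]; rfl
  rw [e, Finset.sum_div]
  refine (norm_sum_le _ _).trans (Finset.sum_le_sum fun u _ => ?_)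
  rw [norm_mul, Complex.norm_real, Real.norm_eq_abs, mul_div_assoc]
  refine mul_le_mul_of_nonneg_left ((exp2 _).trans ?_) (abs_nonneg _)
  rw [div_pow, Real.sq_sqrt (by positivity), div_mul_eq_mul_div]
  have : |(ℓ u - β) / √T| ≤ |ℓ u - β| := by
    rw [abs_div, abs_of_nonneg (Real.sqrt_nonneg _)]
    exact div_le_self (abs_nonneg _) hs
  gcongr

lemma phi_conv (ℓ : V → ℝ) (β : ℝ) (U : Finset V) (p : V → ℝ)
    (h0 : ∑ u ∈ U, p u = 1) (h1 : ∑ u ∈ U, p u * (ℓ u - β) = 0) :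
    Tendsto (fun T : ℕ => wT ℓ β U p T ^ T) atTop
      (𝓝 (Complex.exp (-(∑ u ∈ U, p u * (ℓ u - β)^2 : ℝ) / 2))) := by
  apply Complex.tendsto_pow_exp_of_isLittleO_sub_add_div
  set C : ℝ := ∑ u ∈ U, |p u| * (|ℓ u - β|^3 * Real.exp |ℓ u - β|) with hC
  have hb : ∀ T : ℕ, 1 ≤ T → ‖wT ℓ β U p T - (1 + (-(∑ u ∈ U, p u * (ℓ u - β)^2 : ℝ) / 2) / T)‖
      ≤ C / √T * ‖1 / (T : ℂ)‖ := by
    intro T hT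
    have hT0 : (1:ℝ) ≤ T := by exact_mod_cast hT
    have hs : 1 ≤ √(T:ℝ) := Real.one_le_sqrt.2 hT0
    have hs2 : √(T:ℝ)^2 = T := Real.sq_sqrt (by positivity)
    have hsc : ((√(T:ℝ) : ℝ) : ℂ)^2 = T := by exact_mod_cast hs2
    have hsc0 : ((√(T:ℝ) : ℝ) : ℂ) ≠ 0 := by
      have : √(T:ℝ) ≠ 0 := by positivity
      exact_mod_cast this
    have e : wT ℓ β U p T - (1 + (-(∑ u ∈ U, p u * (ℓ u - β)^2 : ℝ) / 2) / T) = ∑ u ∈ U, (p u : ℂ) *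
      (Complex.exp (((ℓ u - β) / √T : ℝ) * Complex.I) - (1 + ((ℓ u - β) / √T : ℝ) * Complex.I
        - (((ℓ u - β) / √T : ℝ) : ℂ)^2/2)) := by
      have h0' : ∑ u ∈ U, (p u : ℂ) = 1 := by exact_mod_cast h0
      have h1' : ∑ u ∈ U, (p u : ℂ) * ((ℓ u : ℂ) - β) = 0 := by exact_mod_cast h1
      have : (∑ u ∈ U, (p u : ℂ) * (1 + ((ℓ u - β) / √T : ℝ) * Complex.I
        - (((ℓ u - β) / √T : ℝ) : ℂ)^2/2) : ℂ) =
          1 + (-(∑ u ∈ U, p u * (ℓ u - β)^2 : ℝ) / 2) / T := by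
        have : ∀ u, (p u : ℂ) * (1 + ((ℓ u - β) / √T : ℝ) * Complex.I
            - (((ℓ u - β) / √T : ℝ) : ℂ)^2/2)
          = (p u : ℂ) + (p u : ℂ) * ((ℓ u : ℂ) - β) * (Complex.I / (√T : ℝ))
            + ((p u : ℂ) * ((ℓ u : ℂ) - β)^2) * (-1 / 2 / T) := by
          intro u; rw [← hsc]; push_cast; field_simp; ring
        simp_rw [this]
        rw [Finset.sum_add_distrib, Finset.sum_add_distrib, ← Finset.sum_mul, ← Finset.sum_mul,
          h0', h1']
        push_cast; ring
      simp_rw [mul_sub (p _ : ℂ) (Complex.exp _)]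
      rw [Finset.sum_sub_distrib, this]; rfl
    rw [e, hC, Finset.sum_div, Finset.sum_mul]
    refine (norm_sum_le _ _).trans (Finset.sum_le_sum fun u _ => ?_)
    rw [norm_mul, Complex.norm_real, Real.norm_eq_abs, mul_div_assoc, mul_assoc]
    refine mul_le_mul_of_nonneg_left ((exp3 _).trans ?_) (abs_nonneg _)
    have : |(ℓ u - β) / √T| ≤ |ℓ u - β| := by
      rw [abs_div, abs_of_nonneg (Real.sqrt_nonneg _)]
      exact div_le_self (abs_nonneg _) hs
    have e2 : |(ℓ u - β) / √T|^3 = |ℓ u - β|^3 / √T * ‖1 / (T : ℂ)‖ := by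
      rw [abs_div, abs_of_nonneg (Real.sqrt_nonneg _), div_pow, pow_succ (√(T:ℝ)) 2, hs2]
      simp; field_simp
    calc _ ≤ |(ℓ u - β) / √T|^3 * Real.exp |ℓ u - β| := by gcongr
      _ = _ := by rw [e2]; ring
  have hlim : Tendsto (fun T : ℕ => C / √(T:ℝ)) atTop (𝓝 0) :=
    Tendsto.div_atTop tendsto_const_nhds (Real.tendsto_sqrt_atTop.comp tendsto_natCast_atTop_atTop)
  rw [Asymptotics.isLittleO_iff]
  intro ε hε
  filter_upwards [hlim.eventually (ge_mem_nhds hε), eventually_ge_atTop 1] with T h1 h2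
  exact (hb T h2).trans (mul_le_mul_of_nonneg_right h1 (norm_nonneg _))

lemma as_conv [MeasurableSpace S] (π : S → ℝ) (hπ0 : ∀ s, 0 ≤ π s) (hπ1 : ∑ s, π s = 1)
    (Penv : Measure (ℕ → V → S))
    (hiid : ∀ (F : Finset (ℕ × V)) (f : ℕ × V → S),
      Penv {ξ | ∀ p ∈ F, ξ p.1 p.2 = f p} = ∏ p ∈ F, ENNReal.ofReal (π (f p)))
    (P₀ : V → ℝ) (c : V → S → ℝ) (U : Finset V) (x0 : V)
    (hP0 : ∀ u, 0 ≤ P₀ u) (hP1 : ∑ u ∈ U, P₀ u = 1)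
    (hq0 : ∀ u s, 0 ≤ P₀ u + c u s) (hc0 : ∀ s, ∑ u ∈ U, c u s = 0)
    (hcπ : ∀ u, ∑ s, c u s * π s = 0)
    (ℓ : V → ℝ) (β : ℝ) (hadd : ∀ x y, ℓ (x + y) = ℓ x + ℓ y) 
    (hPm : ∑ u ∈ U, P₀ u * (ℓ u - β) = 0)
    (hcm : ∀ s, ∑ u ∈ U, c u s * (ℓ u - β) = 0) :
    ∀ᵐ ξ ∂Penv, Tendsto (fun T => Ew (fun u s => P₀ u + c u s) U x0 ξ T (eT ℓ β T T)) atTop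
      (𝓝 (Complex.exp (-(∑ u ∈ U, P₀ u * (ℓ u - β)^2 : ℝ) / 2))) := by
  set q : V → S → ℝ := fun u s => P₀ u + c u s with hq
  have hq1 : ∀ s, ∑ u ∈ U, q u s = 1 := by
    intro s; simp [hq, Finset.sum_add_distrib, hP1, hc0]
  set W : (ℕ → V → S) → ℕ → ℂ := fun ξ T =>
    Ew q U x0 ξ T (eT ℓ β T T) - wT ℓ β U P₀ T ^ T * eT ℓ β T 0 x0 with hW
  set K : ℝ := 1 + ∑ s, ∑ u ∈ U, |c u s| * ((ℓ u - β)^2 * Real.exp |ℓ u - β|) with hK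
  have hsn : ∀ s, 0 ≤ ∑ u ∈ U, |c u s| * ((ℓ u - β)^2 * Real.exp |ℓ u - β|) := fun s =>
    Finset.sum_nonneg fun u _ => by positivity
  have hK0 : 0 < K := by
    have := Finset.sum_nonneg fun s (_ : s ∈ Finset.univ) => hsn s
    rw [hK]; linarith
  have hKs : ∀ s, ∑ u ∈ U, |c u s| * ((ℓ u - β)^2 * Real.exp |ℓ u - β|) ≤ K := by
    intro s
    have := Finset.single_le_sum (fun s _ => hsn s) (Finset.mem_univ s)
    rw [hK]; linarith
  have key : ∀ z : ℂ, ‖z‖ ≤ 1 → ∀ ε : ℝ, 0 < ε →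
      ∀ᵐ ξ ∂Penv, ∀ᶠ T in atTop, (z * W ξ (T+1)).re < ε := by
    intro z hz ε hε
    have hbd : ∀ T : ℕ, Penv {ξ | ε ≤ (z * W ξ (T+1)).re}
        ≤ ENNReal.ofReal (Real.exp (-(ε^2 / (2 * K^2))) ^ (T+1)) := by
      intro T
      have hT : 1 ≤ T + 1 := by omega
      apply conc_bound π q U x0 hπ0 hπ1 Penv hiid hq0 hq1 (eT ℓ β (T+1))
        (fun t x => (norm_eT _ _ _ _ _).le) (wT ℓ β U P₀ (T+1)) ?_
        (fun s => wT ℓ β U (fun u => c u s) (T+1)) K hK0 (T+1) hT ?_ ?_ ?_ z hz ε hε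
      · refine (norm_sum_le _ _).trans ?_
        rw [← hP1]
        apply Finset.sum_le_sum
        intro u _
        rw [norm_mul, Complex.norm_exp_ofReal_mul_I, Complex.norm_real,
          Real.norm_of_nonneg (hP0 _), mul_one]
      · intro s
        refine (wT_bound ℓ β U (fun u => c u s) (T+1) hT (hc0 s) (hcm s)).trans ?_
        gcongr
        exact hKs s
      · simp only [wT, Finset.mul_sum]
        rw [Finset.sum_comm]
        apply Finset.sum_eq_zero
        intro u _
        have : ∑ s, (c u s : ℂ) * π s = 0 := by exact_mod_cast hcπ u
        simp_rw [← mul_assoc]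
        rw [← Finset.sum_mul]
        simp_rw [mul_comm (π _ : ℂ)]
        rw [this, zero_mul]
      · intro t x s
        simp only [wT, ← Finset.sum_add_distrib, Finset.mul_sum]
        apply Finset.sum_congr rfl
        intro u _
        have : eT ℓ β (T+1) (t+1) (x+u) = eT ℓ β (T+1) t x *
            Complex.exp (((ℓ u - β) / √((T+1 : ℕ) : ℝ) : ℝ) * Complex.I) := by
          simp only [eT, hadd]
          rw [← Complex.exp_add]
          congr 1
          push_cast; ring
        rw [this, Complex.real_smul, hq]
        push_cast; ring
    have hr : Real.exp (-(ε^2 / (2 * K^2))) < 1 := by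
      rw [Real.exp_lt_one_iff]
      have : 0 < ε^2 / (2 * K^2) := by positivity
      linarith
    have hsum : Summable fun T : ℕ => Real.exp (-(ε^2 / (2 * K^2))) ^ (T+1) :=
      (summable_nat_add_iff 1).2 (summable_geometric_of_lt_one (Real.exp_pos _).le hr)
    have := ae_eventually_notMem (μ := Penv) (s := fun T => {ξ | ε ≤ (z * W ξ (T+1)).re})
      (ne_top_of_le_ne_top hsum.tsum_ofReal_ne_top (ENNReal.tsum_le_tsum hbd))
    filter_upwards [this] with ξ hξ
    filter_upwards [hξ] with T hT
    simpa using hT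
  have key2 : ∀ᵐ ξ ∂Penv, ∀ k : ℕ, (∀ᶠ T in atTop, (1 * W ξ (T+1)).re < 1 / ((k:ℝ)+1)) ∧
      (∀ᶠ T in atTop, (-1 * W ξ (T+1)).re < 1 / ((k:ℝ)+1)) ∧
      (∀ᶠ T in atTop, (Complex.I * W ξ (T+1)).re < 1 / ((k:ℝ)+1)) ∧
      (∀ᶠ T in atTop, (-Complex.I * W ξ (T+1)).re < 1 / ((k:ℝ)+1)) := by
    rw [ae_all_iff]
    intro k
    have hk : 0 < 1 / ((k:ℝ)+1) := by positivity
    filter_upwards [key 1 (by simp) _ hk, key (-1) (by simp) _ hk, key Complex.I (by simp) _ hk,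
      key (-Complex.I) (by simp) _ hk] with ξ h1 h2 h3 h4
    exact ⟨h1, h2, h3, h4⟩
  filter_upwards [key2] with ξ hξ
  have hW0 : Tendsto (W ξ) atTop (𝓝 0) := by
    rw [← tendsto_add_atTop_iff_nat 1, Metric.tendsto_atTop']
    intro ε hε
    obtain ⟨k, hk⟩ := exists_nat_one_div_lt (half_pos hε)
    obtain ⟨h1, h2, h3, h4⟩ := hξ k
    obtain ⟨N, hN⟩ := eventually_atTop.1 (h1.and (h2.and (h3.and h4)))
    refine ⟨N, fun T hT => ?_⟩
    obtain ⟨a1, a2, a3, a4⟩ := hN T hT.le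
    simp at a1 a2 a3 a4
    simp only [one_div] at hk
    rw [dist_zero_right]
    refine (Complex.norm_le_abs_re_add_abs_im _).trans_lt ?_
    have b1 : |(W ξ (T+1)).re| < ε/2 := abs_lt.2 ⟨by linarith, by linarith⟩
    have b2 : |(W ξ (T+1)).im| < ε/2 := abs_lt.2 ⟨by linarith, by linarith⟩
    linarith
  have he0 : Tendsto (fun T => eT ℓ β T 0 x0) atTop (𝓝 1) := by
    have h1 : Tendsto (fun T : ℕ => (ℓ x0 - (0:ℕ) * β) / √(T:ℝ)) atTop (𝓝 0) :=
      Tendsto.div_atTop tendsto_const_nhds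
        (Real.tendsto_sqrt_atTop.comp tendsto_natCast_atTop_atTop)
    have h2 : Continuous fun a : ℝ => Complex.exp (a * Complex.I) := by fun_prop
    have h3 := (h2.tendsto 0).comp h1
    simpa [Function.comp_def, eT] using h3
  have := hW0.add ((phi_conv ℓ β U P₀ hP1 hPm).mul he0)
  simpa [hW] using this

end clt


section lip
variable {V : Type} [AddCommGroup V] [DecidableEq V] {S : Type}

lemma exp_lip (a b : ℝ) : ‖Complex.exp (a * Complex.I) - Complex.exp (b * Complex.I)‖ ≤ |a - b| := by
  have h : Complex.exp (a * Complex.I) - Complex.exp (b * Complex.I)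
      = Complex.exp (b * Complex.I) * (Complex.exp (Complex.I * ((a - b : ℝ) : ℂ)) - 1) := by
    rw [mul_sub, ← Complex.exp_add, mul_one]; push_cast; ring_nf
  rw [h, norm_mul, Complex.norm_exp_ofReal_mul_I, one_mul]
  exact Real.norm_exp_I_mul_ofReal_sub_one_le

lemma Ew_lip (q : V → S → ℝ) (U : Finset V) (x0 : V) (ξ : ℕ → V → S)
    (hq0 : ∀ u s, 0 ≤ q u s) (hq1 : ∀ s, ∑ u ∈ U, q u s = 1)
    (ℓ ℓ' : V → ℝ) (β β' : ℝ) (hadd : ∀ x y, ℓ (x + y) = ℓ x + ℓ y)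
    (hadd2 : ∀ x y, ℓ' (x + y) = ℓ' x + ℓ' y)
    (hm : ∀ s, ∑ u ∈ U, q u s * (ℓ u - β) = 0)
    (hm2 : ∀ s, ∑ u ∈ U, q u s * (ℓ' u - β') = 0)
    (δ C C1 : ℝ) (hδ : 0 < δ) (hC1 : 0 ≤ C1)
    (hv : ∀ s, ∑ u ∈ U, q u s * ((ℓ u - ℓ' u) - (β - β'))^2 ≤ δ^2 * C)
    (hx : (ℓ x0 - ℓ' x0)^2 ≤ δ^2 * C1) (T : ℕ) (hT : 1 ≤ T) :
    ‖Ew q U x0 ξ T (eT ℓ β T T) - Ew q U x0 ξ T (eT ℓ' β' T T)‖ ≤ δ * (1 + C1 + C) := by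
  have hT' : (1:ℝ) ≤ T := by exact_mod_cast hT
  have hsub : Ew q U x0 ξ T (eT ℓ β T T) - Ew q U x0 ξ T (eT ℓ' β' T T)
      = Ew q U x0 ξ T (fun x => eT ℓ β T T x - eT ℓ' β' T T x) := by
    rw [sub_eq_iff_eq_add, ← Ew_add]; simp
  rw [hsub]
  refine (Ew_norm q U x0 ξ hq0 T _).trans ?_
  set d : V → ℝ := fun x => ((ℓ x - ℓ' x) - T * (β - β'))^2 with hd
  have hsq : Ew q U x0 ξ T d ≤ δ^2 * C1 + T * (δ^2 * C) := by
    refine (Ew_sq q U x0 ξ (fun x => ℓ x - ℓ' x) (β - β') (δ^2*C) ?_ hq0 hq1 ?_ hv T).trans ?_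
    · intro x y; simp only [hadd, hadd2]; ring
    · intro s
      have : ∑ u ∈ U, q u s * (ℓ u - ℓ' u - (β - β'))
        = ∑ u ∈ U, q u s * (ℓ u - β) - ∑ u ∈ U, q u s * (ℓ' u - β') := by
        rw [← Finset.sum_sub_distrib]; exact Finset.sum_congr rfl fun u _ => by ring
      rw [this, hm, hm2, sub_zero]
    · simpa using hx
  have hle : Ew q U x0 ξ T (fun x => ‖eT ℓ β T T x - eT ℓ' β' T T x‖)
      ≤ Ew q U x0 ξ T (fun x => δ + (1/(δ*T)) • d x) := by
    apply Ew_mono q U x0 ξ hq0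
    intro x
    refine (exp_lip _ _).trans ?_
    rw [← sub_div]
    have hTs : (0:ℝ) < √T := Real.sqrt_pos.2 (by linarith)
    set z := (ℓ x - T * β - (ℓ' x - T * β')) / √T with hz
    have hdz : (1/(δ*T)) • d x = z^2/δ := by
      rw [hz, div_pow, Real.sq_sqrt (by linarith), hd, smul_eq_mul]
      field_simp
      ring
    rw [hdz, ← sq_abs z]
    have : |z| * δ ≤ δ * δ + |z|^2 := by nlinarith [sq_nonneg (|z| - δ), abs_nonneg z]
    calc |z| = |z| * δ / δ := by field_simp
      _ ≤ (δ * δ + |z|^2)/δ := by gcongr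
      _ = _ := by field_simp
  refine hle.trans ?_
  rw [Ew_add, Ew_const q U x0 ξ hq1]
  have := Ew_clm q U x0 ξ ((1/(δ*T)) • (LinearMap.id : ℝ →ₗ[ℝ] ℝ)) T d
  simp only [LinearMap.smul_apply, LinearMap.id_apply] at this
  rw [this, smul_eq_mul]
  have h2 : 1/(δ*T) * Ew q U x0 ξ T d ≤ 1/(δ*T) * (δ^2 * C1 + T * (δ^2 * C)) := by gcongr
  have h3 : 1/(δ*T) * (δ^2 * C1 + T * (δ^2 * C)) = δ * C1 / T + δ * C := by field_simp
  have h4 : δ * C1 / T ≤ δ * C1 := div_le_self (by positivity) hT'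
  linarith
end lip

noncomputable def lin {n : ℕ} (l : Fin n → ℝ) (x : Fin n → ℤ) : ℝ := ∑ i, l i * (x i : ℝ)
noncomputable def bet {n : ℕ} (b l : Fin n → ℝ) : ℝ := ∑ i, l i * b i

lemma lin_add {n : ℕ} (l : Fin n → ℝ) (x y : Fin n → ℤ) : lin l (x + y) = lin l x + lin l y := by
  simp [lin, mul_add, Finset.sum_add_distrib]

lemma lin_sub_bet {n : ℕ} (b l : Fin n → ℝ) (x : Fin n → ℤ) :
    lin l x - bet b l = ∑ i, l i * ((x i : ℝ) - b i) := by
  simp [lin, bet, mul_sub, Finset.sum_sub_distrib]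

lemma abs_lin_le {n : ℕ} (l m y : Fin n → ℝ) (δ : ℝ) (h : ∀ i, |l i - m i| ≤ δ) :
    |∑ i, l i * y i - ∑ i, m i * y i| ≤ δ * ∑ i, |y i| := by
  rw [← Finset.sum_sub_distrib, Finset.mul_sum]
  refine (Finset.abs_sum_le_sum_abs _ _).trans (Finset.sum_le_sum fun i _ => ?_)
  rw [← sub_mul, abs_mul]
  exact mul_le_mul_of_nonneg_right (h i) (abs_nonneg _)

lemma dense_ext {n : ℕ} {S : Type} (q : (Fin n → ℤ) → S → ℝ) (U : Finset (Fin n → ℤ))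
    (x0 : Fin n → ℤ) (ξ : ℕ → (Fin n → ℤ) → S)
    (hq0 : ∀ u s, 0 ≤ q u s) (hqle : ∀ u s, q u s ≤ 1) (hq1 : ∀ s, ∑ u ∈ U, q u s = 1)
    (b : Fin n → ℝ)
    (hm : ∀ l s, ∑ u ∈ U, q u s * (lin l u - bet b l) = 0)
    (L : (Fin n → ℝ) → ℂ) (hL : Continuous L)
    (hr : ∀ r : Fin n → ℚ, Tendsto (fun T => Ew q U x0 ξ T
      (eT (lin fun i => (r i : ℝ)) (bet b fun i => (r i : ℝ)) T T)) atTop (𝓝 (L fun i => (r i : ℝ))))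
    (l : Fin n → ℝ) :
    Tendsto (fun T => Ew q U x0 ξ T (eT (lin l) (bet b l) T T)) atTop (𝓝 (L l)) := by
  set C : ℝ := ∑ u ∈ U, (∑ i, |(u i : ℝ) - b i|)^2 with hC
  set C1 : ℝ := (∑ i, |(x0 i : ℝ)|)^2 with hC1
  have hC0 : 0 ≤ C := Finset.sum_nonneg fun u _ => sq_nonneg _
  have hC10 : 0 ≤ C1 := sq_nonneg _
  rw [Metric.tendsto_atTop]
  intro ε hε
  set δ : ℝ := ε / (4 * (1 + C1 + C)) with hδ
  have hK : 0 < 1 + C1 + C := by linarith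
  have hδ0 : 0 < δ := by positivity
  obtain ⟨η, hη, hLη⟩ := Metric.continuousAt_iff.1 (hL.continuousAt (x := l)) (ε/4) (by positivity)
  have hdr : DenseRange (Pi.map (fun (_ : Fin n) (r : ℚ) => (r : ℝ))) :=
    DenseRange.piMap fun _ => Rat.denseRange_cast
  obtain ⟨r, hrl⟩ := hdr.exists_dist_lt l (lt_min hδ0 hη)
  set m : Fin n → ℝ := fun i => (r i : ℝ) with hmm
  have hrl' : dist l m < min δ η := hrl
  have hcl : ∀ i, |l i - m i| ≤ δ := by
    intro i
    have := (dist_le_pi_dist l m i).trans (hrl'.le.trans (min_le_left _ _))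
    rwa [Real.dist_eq] at this
  have hLm : dist (L m) (L l) < ε/4 := hLη (by rw [dist_comm]; exact hrl'.trans_le (min_le_right _ _))
  obtain ⟨N, hN⟩ := Metric.tendsto_atTop.1 (hr r) (ε/4) (by positivity)
  refine ⟨max N 1, fun T hT => ?_⟩
  have h1 := hN T (le_of_max_le_left hT)
  have h2 := Ew_lip q U x0 ξ hq0 hq1 (lin l) (lin m) (bet b l) (bet b m) (lin_add l) (lin_add m)
    (hm l) (hm m) δ C C1 hδ0 hC10 (by
      intro s
      rw [hC, Finset.mul_sum]
      refine Finset.sum_le_sum fun u _ => ?_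
      have : lin l u - lin m u - (bet b l - bet b m) = (lin l u - bet b l) - (lin m u - bet b m) := by ring
      rw [this, lin_sub_bet, lin_sub_bet, ← mul_pow]
      refine (mul_le_of_le_one_left (sq_nonneg _) (hqle _ _)).trans ?_
      rw [← sq_abs]
      exact pow_le_pow_left₀ (abs_nonneg _) (abs_lin_le l m _ δ hcl) 2) (by
      rw [hC1, ← mul_pow, ← sq_abs]
      exact pow_le_pow_left₀ (abs_nonneg _) (abs_lin_le l m _ δ hcl) 2) T (le_of_max_le_right hT)
  rw [← dist_eq_norm] at h2
  have h3 : δ * (1 + C1 + C) = ε/4 := by rw [hδ]; field_simp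
  have h4 := dist_triangle4 (Ew q U x0 ξ T (eT (lin l) (bet b l) T T))
    (Ew q U x0 ξ T (eT (lin m) (bet b m) T T)) (L m) (L l)
  linarith


lemma gauss_exists {n : ℕ} (H : Fin n → Fin n → ℝ) (hsym : ∀ i j, H i j = H j i)
    (hpos : ∀ l : Fin n → ℝ, 0 ≤ ∑ i, ∑ j, l i * l j * H i j) :
    ∃ G : Measure (EuclideanSpace ℝ (Fin n)), IsProbabilityMeasure G ∧
      ∀ l : EuclideanSpace ℝ (Fin n), charFun G l
        = Complex.exp (-(∑ i, ∑ j, l i * l j * H i j : ℝ) / 2) := by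
  have hquad : ∀ x : Fin n → ℝ, x ⬝ᵥ (Matrix.of H).mulVec x = ∑ i, ∑ j, x i * x j * H i j := by
    intro x
    simp only [dotProduct, Matrix.mulVec, Matrix.of_apply, Finset.mul_sum]
    exact Finset.sum_congr rfl fun i _ => Finset.sum_congr rfl fun j _ => by ring
  have hS : (Matrix.of H).PosSemidef := by
    refine Matrix.PosSemidef.of_dotProduct_mulVec_nonneg ?_ ?_
    · ext i j; simp [hsym j i]
    · intro x
      rw [star_trivial, hquad]; exact hpos x
  refine ⟨multivariateGaussian 0 (Matrix.of H), inferInstance, fun l => ?_⟩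
  rw [charFun_multivariateGaussian hS, hquad]
  congr 1
  simp [neg_div]

lemma gauss_marg {n : ℕ} (H : Fin n → Fin n → ℝ) 
    (hpos : ∀ l : Fin n → ℝ, 0 ≤ ∑ i, ∑ j, l i * l j * H i j)
    (G : Measure (EuclideanSpace ℝ (Fin n))) [IsProbabilityMeasure G]
    (hG : ∀ l : EuclideanSpace ℝ (Fin n), charFun G l
        = Complex.exp (-(∑ i, ∑ j, l i * l j * H i j : ℝ) / 2)) (l : Fin n → ℝ) :
    (G.map (fun v => (v.ofLp : Fin n → ℝ))).map (fun v => ∑ i, l i * v i)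
      = gaussianReal 0 (Real.toNNReal (∑ i, ∑ j, l i * l j * H i j)) := by
  have hm1 : Measurable (fun v : EuclideanSpace ℝ (Fin n) => (v.ofLp : Fin n → ℝ)) := by fun_prop
  have hm2 : Measurable (fun v : Fin n → ℝ => ∑ i, l i * v i) := by fun_prop
  rw [Measure.map_map hm2 hm1]
  have hm3 := hm2.comp hm1
  have : IsProbabilityMeasure (G.map ((fun v : Fin n → ℝ => ∑ i, l i * v i) ∘ (fun v : EuclideanSpace ℝ (Fin n) => (v.ofLp : Fin n → ℝ)))) :=
    Measure.isProbabilityMeasure_map hm3.aemeasurable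
  apply Measure.ext_of_charFun
  ext t
  rw [charFun_gaussianReal, charFun_apply_real, integral_map hm3.aemeasurable (by fun_prop)]
  have h := hG (WithLp.toLp 2 (fun i => t * l i))
  rw [charFun_apply] at h
  have e1 : ∀ v : EuclideanSpace ℝ (Fin n), inner ℝ v (WithLp.toLp 2 (fun i => t * l i))
      = t * ∑ i, l i * v i := by
    intro v
    simp only [PiLp.inner_apply, RCLike.inner_apply, conj_trivial, Finset.mul_sum]
    exact Finset.sum_congr rfl fun i _ => by ring
  simp only [e1] at h
  simp only [Function.comp_apply]
  rw [← Complex.ofReal_pow] 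
  rw [Real.coe_toNNReal _ (hpos l)]
  convert h using 1
  · simp
  · congr 1
    have : ∑ i, ∑ j, t * l i * (t * l j) * H i j = (∑ i, ∑ j, l i * l j * H i j) * t^2 := by
      rw [Finset.sum_mul]
      refine Finset.sum_congr rfl fun i _ => ?_
      rw [Finset.sum_mul]
      exact Finset.sum_congr rfl fun j _ => by ring
    rw [this]; push_cast; ring

lemma conv_of_char {n : ℕ} {Ω : Type} [MeasurableSpace Ω] (μ : Measure Ω) [IsProbabilityMeasure μ]
    (Z : ℕ → Ω → Fin n → ℝ) (hZ : ∀ t, Measurable (Z t))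
    (G : Measure (EuclideanSpace ℝ (Fin n))) [IsProbabilityMeasure G]
    (h : ∀ l : Fin n → ℝ, Tendsto (fun t => ∫ ω, Complex.exp ((∑ i, l i * Z t ω i : ℝ) * Complex.I) ∂μ)
      atTop (𝓝 (charFun G (WithLp.toLp 2 l))))
    (f : BoundedContinuousFunction (Fin n → ℝ) ℝ) :
    Tendsto (fun t => ∫ ω, f (Z t ω) ∂μ) atTop
      (𝓝 (∫ v, f v ∂(G.map (fun v => (v.ofLp : Fin n → ℝ))))) := by
  have hm1 : Measurable (fun v : EuclideanSpace ℝ (Fin n) => (v.ofLp : Fin n → ℝ)) := by fun_prop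
  have hc1 : Continuous (fun v : EuclideanSpace ℝ (Fin n) => (v.ofLp : Fin n → ℝ)) := by fun_prop
  have hm2 : ∀ t, Measurable (fun ω => (WithLp.toLp 2 (Z t ω) : EuclideanSpace ℝ (Fin n))) := by
    intro t; have := hZ t; fun_prop
  let ν : ℕ → ProbabilityMeasure (EuclideanSpace ℝ (Fin n)) := fun t =>
    ⟨μ.map (fun ω => WithLp.toLp 2 (Z t ω)), Measure.isProbabilityMeasure_map (hm2 t).aemeasurable⟩
  let G' : ProbabilityMeasure (EuclideanSpace ℝ (Fin n)) := ⟨G, inferInstance⟩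
  have hν : Tendsto ν atTop (𝓝 G') := by
    rw [ProbabilityMeasure.tendsto_iff_tendsto_charFun]
    intro l
    refine (h l.ofLp).congr fun t => ?_
    change _ = charFun (μ.map (fun ω => WithLp.toLp 2 (Z t ω))) l
    rw [charFun_apply, integral_map (hm2 t).aemeasurable (by fun_prop)]
    refine integral_congr_ae (Eventually.of_forall fun ω => ?_)
    simp only [PiLp.inner_apply, RCLike.inner_apply, conj_trivial]
  rw [ProbabilityMeasure.tendsto_iff_forall_integral_tendsto] at hν
  have := hν (f.compContinuous ⟨_, hc1⟩)
  rw [integral_map hm1.aemeasurable f.continuous.aestronglyMeasurable]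
  refine this.congr fun t => ?_
  change ∫ v, f v.ofLp ∂(μ.map (fun ω => WithLp.toLp 2 (Z t ω))) = _
  exact integral_map (hm2 t).aemeasurable (f.continuous.comp hc1).aestronglyMeasurable


/-- **Quenched central limit theorem** (Boldrighini–Minlos–Pellegrinotti model):
for almost every realization `ξ` of the environment, under the quenched law `P_ξ`
the rescaled centered walk `t^{-1/2} Y_t` converges in distribution to a centered
`n`-dimensional Gaussian vector with covariance matrix `η²`. -/
theorem quenched_clt
    {n : ℕ} (hn : 1 ≤ n)
    {S : Type} [Fintype S] [MeasurableSpace S]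
    (π : S → ℝ) (hπ0 : ∀ s, 0 ≤ π s) (hπ1 : ∑ s : S, π s = 1)
    {Ω : Type} [MeasurableSpace Ω]
    -- the random walk in random environment
    (X : ℕ → Ω → (Fin n → ℤ)) (hX : ∀ t, Measurable (X t))
    -- the law of the i.i.d. environment, with marginals π
    (Penv : Measure (ℕ → (Fin n → ℤ) → S)) (hPenv : IsProbabilityMeasure Penv)
    (hiid : ∀ (F : Finset (ℕ × (Fin n → ℤ))) (f : ℕ × (Fin n → ℤ) → S),
      Penv {ξ | ∀ p ∈ F, ξ p.1 p.2 = f p} = ∏ p ∈ F, ENNReal.ofReal (π (f p)))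
    -- the free transition kernel P₀ and the environment perturbation c
    (P₀ : (Fin n → ℤ) → ℝ) (c : (Fin n → ℤ) → S → ℝ)
    (hP₀fin : (Function.support P₀).Finite)
    (hcfin : ∀ s, (Function.support fun u => c u s).Finite)
    (hP₀nonneg : ∀ u, 0 ≤ P₀ u) (hP₀sum : ∑ᶠ u : Fin n → ℤ, P₀ u = 1)
    (hrange : ∀ u s, 0 ≤ P₀ u + c u s ∧ P₀ u + c u s ≤ 1)
    (hcsum : ∀ s, ∑ᶠ u : Fin n → ℤ, c u s = 0)
    (hcπ : ∀ u, ∑ s : S, c u s * π s = 0)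
    -- the drifts b^c, b⁰ and b = b⁰ + b^c
    (bc : Fin n → ℝ) (hbc : ∀ s i, ∑ᶠ u : Fin n → ℤ, (u i : ℝ) * c u s = bc i)
    (b : Fin n → ℝ) (hb : ∀ i, b i = (∑ᶠ u : Fin n → ℤ, (u i : ℝ) * P₀ u) + bc i)
    -- the centered walk Y_t = X_t − t b
    (Y : ℕ → Ω → (Fin n → ℝ))
    (hY : ∀ t ω i, Y t ω i = (X t ω i : ℝ) - t * b i)
    -- the quenched laws P_ξ and the Markov property of the walk given the environment
    (P : (ℕ → (Fin n → ℤ) → S) → Measure Ω)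
    (hP : ∀ ξ, IsProbabilityMeasure (P ξ))
    (hMarkov : ∀ ξ t (xs : ℕ → (Fin n → ℤ)) (y : Fin n → ℤ),
      P ξ {ω | (∀ r ≤ t, X r ω = xs r) ∧ X (t + 1) ω = y}
        = ENNReal.ofReal (P₀ (y - xs t) + c (y - xs t) (ξ t (xs t)))
          * P ξ {ω | ∀ r ≤ t, X r ω = xs r})
 :
    ∀ᵐ ξ ∂Penv, ∃ μG : Measure (Fin n → ℝ), IsProbabilityMeasure μG ∧
      -- μG is the centered Gaussian law on ℝⁿ with covariance matrix η²
      (∀ l : Fin n → ℝ,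
        μG.map (fun v => ∑ i, l i * v i)
          = gaussianReal 0 (Real.toNNReal (∑ i, ∑ j, l i * l j * etaSq π P₀ c b i j))) ∧
      -- and t^{-1/2} Y_t converges in distribution to μG under P_ξ
      ∀ f : BoundedContinuousFunction (Fin n → ℝ) ℝ,
        Tendsto (fun t : ℕ => ∫ ω, f (fun i => Y t ω i / Real.sqrt t) ∂(P ξ))
          atTop (𝓝 (∫ v, f v ∂μG)) := by
  classical
  set U : Finset (Fin n → ℤ) := hP₀fin.toFinset ∪ Finset.univ.biUnion (fun s => (hcfin s).toFinset) with hU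
  have hP0U : ∀ u, u ∉ U → P₀ u = 0 := by
    intro u hu
    by_contra h
    exact hu (Finset.mem_union_left _ (hP₀fin.mem_toFinset.2 h))
  have hcU : ∀ u s, u ∉ U → c u s = 0 := by
    intro u s hu
    by_contra h
    exact hu (Finset.mem_union_right _ (Finset.mem_biUnion.2
      ⟨s, Finset.mem_univ _, (hcfin s).mem_toFinset.2 h⟩))
  have hfs : ∀ g : (Fin n → ℤ) → ℝ, (∀ u, u ∉ U → g u = 0) → ∑ᶠ u, g u = ∑ u ∈ U, g u := by
    intro g hg
    apply finsum_eq_sum_of_support_subset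
    intro u hu
    by_contra h
    exact hu (hg u (by simpa using h))
  have hP1 : ∑ u ∈ U, P₀ u = 1 := by rw [← hfs _ hP0U]; exact hP₀sum
  have hc0 : ∀ s, ∑ u ∈ U, c u s = 0 := fun s => by rw [← hfs _ (fun u => hcU u s)]; exact hcsum s
  have hbcs : ∀ s i, ∑ u ∈ U, (u i : ℝ) * c u s = bc i := fun s i => by
    rw [← hfs _ (fun u hu => by rw [hcU u s hu, mul_zero])]; exact hbc s i
  have hbc0 : ∀ i, bc i = 0 := by
    intro i
    have h1 : ∑ s, π s * bc i = bc i := by rw [← Finset.sum_mul, hπ1, one_mul]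
    rw [← h1]
    calc ∑ s, π s * bc i = ∑ s, ∑ u ∈ U, (u i : ℝ) * (c u s * π s) := by
          refine Finset.sum_congr rfl fun s _ => ?_
          rw [← hbcs s i, Finset.mul_sum]
          exact Finset.sum_congr rfl fun u _ => by ring
      _ = 0 := by
          rw [Finset.sum_comm]
          refine Finset.sum_eq_zero fun u _ => ?_
          rw [← Finset.mul_sum, hcπ, mul_zero]
  have hbs : ∀ i, ∑ u ∈ U, (u i : ℝ) * P₀ u = b i := by
    intro i
    rw [hb, hbc0, add_zero, hfs _ (fun u hu => by rw [hP0U u hu, mul_zero])]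
  have hPm : ∀ l, ∑ u ∈ U, P₀ u * (lin l u - bet b l) = 0 := by
    intro l
    simp only [lin_sub_bet, Finset.mul_sum]
    rw [Finset.sum_comm]
    refine Finset.sum_eq_zero fun i _ => ?_
    calc ∑ u ∈ U, P₀ u * (l i * ((u i : ℝ) - b i))
        = l i * (∑ u ∈ U, (u i : ℝ) * P₀ u) - l i * b i * ∑ u ∈ U, P₀ u := by
          rw [Finset.mul_sum, Finset.mul_sum, ← Finset.sum_sub_distrib]
          exact Finset.sum_congr rfl fun u _ => by ring
      _ = 0 := by rw [hbs, hP1]; ring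
  have hcm : ∀ l s, ∑ u ∈ U, c u s * (lin l u - bet b l) = 0 := by
    intro l s
    simp only [lin_sub_bet, Finset.mul_sum]
    rw [Finset.sum_comm]
    refine Finset.sum_eq_zero fun i _ => ?_
    calc ∑ u ∈ U, c u s * (l i * ((u i : ℝ) - b i))
        = l i * (∑ u ∈ U, (u i : ℝ) * c u s) - l i * b i * ∑ u ∈ U, c u s := by
          rw [Finset.mul_sum, Finset.mul_sum, ← Finset.sum_sub_distrib]
          exact Finset.sum_congr rfl fun u _ => by ring
      _ = 0 := by rw [hbcs, hc0, hbc0]; ring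
  have hπc : ∀ u, ∑ s, π s * c u s = 0 := fun u => by
    rw [← hcπ u]; exact Finset.sum_congr rfl fun s _ => mul_comm _ _
  have heta : ∀ i j, etaSq π P₀ c b i j
      = ∑ u ∈ U, ((u i : ℝ) - b i) * ((u j : ℝ) - b j) * P₀ u := by
    intro i j
    simp only [etaSq, hπc, add_zero]
    exact hfs _ (fun u hu => by rw [hP0U u hu, mul_zero])
  have hquad : ∀ l : Fin n → ℝ, ∑ i, ∑ j, l i * l j * etaSq π P₀ c b i j
      = ∑ u ∈ U, P₀ u * (lin l u - bet b l)^2 := by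
    intro l
    have h1 : ∀ u : Fin n → ℤ, P₀ u * (lin l u - bet b l)^2
        = ∑ i, ∑ j, l i * l j * (((u i : ℝ) - b i) * ((u j : ℝ) - b j) * P₀ u) := by
      intro u
      rw [lin_sub_bet, sq, Finset.sum_mul_sum, Finset.mul_sum]
      refine Finset.sum_congr rfl fun i _ => ?_
      rw [Finset.mul_sum]
      exact Finset.sum_congr rfl fun j _ => by ring
    simp only [h1, heta, Finset.mul_sum]
    rw [Finset.sum_comm (s := U)]
    refine Finset.sum_congr rfl fun i _ => ?_
    rw [Finset.sum_comm (s := U)]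
  have hpos : ∀ l : Fin n → ℝ, 0 ≤ ∑ i, ∑ j, l i * l j * etaSq π P₀ c b i j := by
    intro l
    rw [hquad]
    exact Finset.sum_nonneg fun u _ => mul_nonneg (hP₀nonneg u) (sq_nonneg _)
  have hsym : ∀ i j, etaSq π P₀ c b i j = etaSq π P₀ c b j i := by
    intro i j
    rw [heta, heta]
    exact Finset.sum_congr rfl fun u _ => by ring
  obtain ⟨G, hGp, hG⟩ := gauss_exists (etaSq π P₀ c b) hsym hpos
  set q : (Fin n → ℤ) → S → ℝ := fun u s => P₀ u + c u s with hq
  have hq0 : ∀ u s, 0 ≤ q u s := fun u s => (hrange u s).1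
  have hqle : ∀ u s, q u s ≤ 1 := fun u s => (hrange u s).2
  have hq1 : ∀ s, ∑ u ∈ U, q u s = 1 := by
    intro s
    simp only [hq, Finset.sum_add_distrib, hP1, hc0, add_zero]
  have hqU : ∀ u s, u ∉ U → q u s = 0 := fun u s hu => by
    simp only [hq, hP0U u hu, hcU u s hu, add_zero]
  have hqm : ∀ l s, ∑ u ∈ U, q u s * (lin l u - bet b l) = 0 := by
    intro l s
    simp only [hq, add_mul, Finset.sum_add_distrib, hPm, hcm, add_zero]
  let L : (Fin n → ℝ) → ℂ := fun l =>
    Complex.exp (-(∑ i, ∑ j, l i * l j * etaSq π P₀ c b i j : ℝ) / 2)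
  have hLc : Continuous L := by
    simp only [L]
    fun_prop
  have hae : ∀ᵐ ξ ∂Penv, ∀ x0 : Fin n → ℤ, ∀ r : Fin n → ℚ,
      Tendsto (fun T => Ew q U x0 ξ T
        (eT (lin fun i => (r i : ℝ)) (bet b fun i => (r i : ℝ)) T T)) atTop
          (𝓝 (L fun i => (r i : ℝ))) := by
    rw [ae_all_iff]; intro x0
    rw [ae_all_iff]; intro r
    have := as_conv π hπ0 hπ1 Penv hiid P₀ c U x0 hP₀nonneg hP1 (fun u s => (hrange u s).1) hc0 hcπ
      (lin fun i => (r i : ℝ)) (bet b fun i => (r i : ℝ)) (lin_add _) (hPm _) (hcm _)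
    simp only [L, hquad]
    exact this
  filter_upwards [hae] with ξ hξ
  have hprob := hP ξ
  have hm1 : Measurable (fun v : EuclideanSpace ℝ (Fin n) => (v.ofLp : Fin n → ℝ)) := by fun_prop
  refine ⟨G.map (fun v => (v.ofLp : Fin n → ℝ)), Measure.isProbabilityMeasure_map hm1.aemeasurable,
    gauss_marg (etaSq π P₀ c b) hpos G hG, ?_⟩
  refine conv_of_char (P ξ) (fun t ω i => Y t ω i / Real.sqrt t) ?_ G ?_
  · intro t
    refine measurable_pi_lambda _ fun i => ?_
    simp only [hY]
    have h1 : Measurable (fun ω => (X t ω i : ℝ)) :=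
      (measurable_of_countable (fun z : ℤ => (z : ℝ))).comp ((measurable_pi_apply i).comp (hX t))
    exact (h1.sub_const _).div_const _
  · intro l
    rw [hG]
    have hfin := link_tendsto (P ξ) X hX q U ξ hq0 hq1 hqU (hMarkov ξ)
      (fun t => eT (lin l) (bet b l) t t) (fun t x => (norm_eT _ _ _ _ _).le) (L l)
      (fun x0 => dense_ext q U x0 ξ hq0 hqle hq1 b hqm L hLc (hξ x0) l)
    refine hfin.congr fun t => integral_congr_ae (Eventually.of_forall fun ω => ?_)
    simp only [eT]
    congr 3
    simp only [hY, lin, bet]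
    rw [Finset.mul_sum, ← Finset.sum_sub_distrib, Finset.sum_div]
    exact Finset.sum_congr rfl fun i _ => by ring
end

section
/- For almost every realization ξ of the environment, P_ξ-almost surely the normalized quadratic covariation matrix of Y converges: (1/t)[Y]_t → η² as t → ∞, where ([Y]_t)_{ij} = Σ_{0≤r<t} (Y^i_{r+1} − Y^i_r)(Y^j_{r+1} − Y^j_r) and (η²)_{ij} = Σ_{u∈ℤⁿ} (u_i − b_i)(u_j − b_j) P̄(u). -/
open MeasureTheory ProbabilityTheory Filter Topology

lemma qqv_nm {α : Type*} [MeasurableSpace α] (μ : Measure α) [IsProbabilityMeasure μ] (A : Set α)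
    (h : μ A + μ Aᶜ ≤ 1) : NullMeasurableSet A μ := by
  set B := toMeasurable μ A with hB
  set C := toMeasurable μ Aᶜ with hC
  have hAB : A ⊆ B := subset_toMeasurable _ _
  have hAC : Aᶜ ⊆ C := subset_toMeasurable _ _
  have hU : B ∪ C = Set.univ := by
    ext x
    by_cases hx : x ∈ A
    · simp [hAB hx]
    · simp [hAC hx]
  have h1 : μ (B ∪ C) + μ (B ∩ C) = μ B + μ C :=
    measure_union_add_inter B (measurableSet_toMeasurable _ _)
  rw [hU, measure_univ, hB, hC, measure_toMeasurable, measure_toMeasurable, ← hB, ← hC] at h1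
  have h2 : μ (B ∩ C) = 0 := by
    have h3 : 1 + μ (B ∩ C) ≤ 1 + 0 := by rw [h1]; simpa using h
    exact le_antisymm ((ENNReal.add_le_add_iff_left ENNReal.one_ne_top).1 h3) (zero_le)
  have h3 : μ (B \ A) = 0 := by
    refine measure_mono_null ?_ h2
    intro x hx
    exact ⟨hx.1, hAC hx.2⟩
  refine ⟨B, measurableSet_toMeasurable _ _, ?_⟩
  refine (ae_le_set.2 ?_).antisymm (ae_le_set.2 h3)
  simp [Set.sdiff_eq_empty.2 hAB]

lemma qqv_single {E S : Type} [Fintype S] [MeasurableSpace S]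
    (π : S → ℝ) (hπ0 : ∀ s, 0 ≤ π s) (hπ1 : ∑ s : S, π s = 1)
    (Penv : Measure (ℕ → E → S)) [IsProbabilityMeasure Penv]
    (hiid : ∀ (F : Finset (ℕ × E)) (f : ℕ × E → S),
      Penv {ξ | ∀ p ∈ F, ξ p.1 p.2 = f p} = ∏ p ∈ F, ENNReal.ofReal (π (f p)))
    (r : ℕ) (x : E) (s : S) : NullMeasurableSet {ξ : ℕ → E → S | ξ r x = s} Penv := by
  classical
  have h0 : ∀ s, Penv {ξ : ℕ → E → S | ξ r x = s} = ENNReal.ofReal (π s) := by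
    intro s
    have := hiid {(r, x)} (fun _ => s)
    simpa using this
  apply qqv_nm
  have h1 : Penv {ξ : ℕ → E → S | ξ r x = s}ᶜ
      ≤ ∑ s' ∈ Finset.univ.erase s, ENNReal.ofReal (π s') := by
    calc _ ≤ Penv (⋃ s' ∈ Finset.univ.erase s, {ξ : ℕ → E → S | ξ r x = s'}) := by
          apply measure_mono
          intro ξ hξ
          simpa using hξ
      _ ≤ _ := by
          refine (measure_biUnion_finset_le _ _).trans ?_
          simp [h0]
  calc _ ≤ ENNReal.ofReal (π s) + ∑ s' ∈ Finset.univ.erase s, ENNReal.ofReal (π s') := by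
        rw [h0]; gcongr
    _ = ∑ s', ENNReal.ofReal (π s') :=
        Finset.add_sum_erase Finset.univ (fun s' => ENNReal.ofReal (π s')) (Finset.mem_univ s)
    _ = 1 := by
        rw [← ENNReal.ofReal_sum_of_nonneg (fun s _ => hπ0 s), hπ1, ENNReal.ofReal_one]
    _ ≤ 1 := le_rfl

lemma qqv_env {E S : Type} [Fintype S] [MeasurableSpace S]
    (π : S → ℝ) (hπ0 : ∀ s, 0 ≤ π s) (hπ1 : ∑ s : S, π s = 1)
    (Penv : Measure (ℕ → E → S)) [IsProbabilityMeasure Penv]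
    (hiid : ∀ (F : Finset (ℕ × E)) (f : ℕ × E → S),
      Penv {ξ | ∀ p ∈ F, ξ p.1 p.2 = f p} = ∏ p ∈ F, ENNReal.ofReal (π (f p)))
    (t : ℕ) (x : Fin t → E) (a : Fin t → S → ENNReal) :
    AEMeasurable (fun ξ : ℕ → E → S => ∏ r : Fin t, a r (ξ r (x r))) Penv ∧
    ∫⁻ ξ, ∏ r : Fin t, a r (ξ r (x r)) ∂Penv = ∏ r, ∑ s, a r s * ENNReal.ofReal (π s) := by
  classical
  have hne : Nonempty S := by
    by_contra h
    rw [not_nonempty_iff] at h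
    simp at hπ1
  let T : (Fin t → S) → Set (ℕ → E → S) := fun s => {ξ | ∀ r : Fin t, ξ r (x r) = s r}
  have hT : ∀ s, NullMeasurableSet (T s) Penv := by
    intro s
    have : T s = ⋂ r : Fin t, {ξ : ℕ → E → S | ξ r (x r) = s r} := by
      ext ξ; simp [T]
    rw [this]
    exact NullMeasurableSet.iInter fun r => qqv_single π hπ0 hπ1 Penv hiid _ _ _
  have hTm : ∀ s, Penv (T s) = ∏ r, ENNReal.ofReal (π (s r)) := by
    intro s
    let e : Fin t ↪ ℕ × E := ⟨fun r => (r, x r), fun r r' h => Fin.ext (Prod.ext_iff.1 h).1⟩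
    let f : ℕ × E → S := fun p => if h : p.1 < t then s ⟨p.1, h⟩ else Classical.arbitrary S
    have := hiid (Finset.univ.map e) f
    rw [Finset.prod_map] at this
    have he : ∀ r, e r = ((r : ℕ), x r) := fun r => rfl
    have hf : ∀ r, f (e r) = s r := fun r => by simp [he, f]
    simp only [hf] at this
    rw [← this]
    congr 1
    ext ξ
    simp only [T, Set.mem_setOf_eq, Finset.mem_map, Finset.mem_univ, true_and,
      forall_exists_index, forall_apply_eq_imp_iff, hf]
    rfl
  have hfun : (fun ξ : ℕ → E → S => ∏ r : Fin t, a r (ξ r (x r)))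
      = fun ξ => ∑ s : Fin t → S, (T s).indicator (fun _ => ∏ r, a r (s r)) ξ := by
    funext ξ
    rw [Finset.sum_eq_single (fun r : Fin t => ξ r (x r))]
    · rw [Set.indicator_of_mem]
      simp [T]
    · intro s _ hs
      rw [Set.indicator_of_notMem]
      intro h
      exact hs (funext fun r => (h r).symm)
    · simp
  have hm : ∀ s : Fin t → S, AEMeasurable ((T s).indicator (fun _ => ∏ r, a r (s r))) Penv :=
    fun s => aemeasurable_const.indicator₀ (hT s)
  constructor
  · rw [hfun]
    exact Finset.aemeasurable_fun_sum _ fun s _ => hm s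
  · rw [hfun, lintegral_finsetSum' _ fun s _ => hm s, Finset.prod_univ_sum]
    simp only [Fintype.piFinset_univ]
    refine Finset.sum_congr rfl fun s _ => ?_
    rw [lintegral_indicator_const₀ (hT s), hTm, Finset.prod_mul_distrib]

/-- moments -/
noncomputable def qqvM {ι : Type} [Fintype ι] (p g : ι → ℝ) (k t : ℕ) : ℝ :=
  ∑ u : Fin t → ι, (∏ r, p (u r)) * (∑ r, g (u r)) ^ k

lemma qqv_succ {ι : Type} [Fintype ι] (t : ℕ) (H : (Fin (t+1) → ι) → ℝ) :
    ∑ u : Fin (t+1) → ι, H u = ∑ u : Fin t → ι, ∑ v : ι, H (Fin.cons v u) := by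
  rw [← (Fin.consEquiv (fun _ => ι)).sum_comp, Fintype.sum_prod_type, Finset.sum_comm]
  rfl

lemma qqv_M {ι : Type} [Fintype ι] (p g : ι → ℝ) (hp : ∀ v, 0 ≤ p v) (hp1 : ∑ v, p v = 1)
    (hg : ∑ v, p v * g v = 0) (t : ℕ) :
    qqvM p g 0 t = 1 ∧ qqvM p g 1 t = 0 ∧ qqvM p g 2 t = t * ∑ v, p v * g v ^ 2 ∧
    qqvM p g 4 t = 3 * t * (t - 1) * (∑ v, p v * g v ^ 2) ^ 2 + t * ∑ v, p v * g v ^ 4 := by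
  have hrec : ∀ k t, qqvM p g k (t+1) = ∑ u : Fin t → ι, ∑ v : ι,
      (∏ r, p (u r)) * p v * (g v + ∑ r, g (u r)) ^ k := by
    intro k t
    unfold qqvM
    rw [qqv_succ]
    refine Finset.sum_congr rfl fun u _ => Finset.sum_congr rfl fun v _ => ?_
    simp only [Fin.prod_univ_succ, Fin.sum_univ_succ, Fin.cons_zero, Fin.cons_succ]
    ring
  have hsep : ∀ (k t : ℕ) (G : ι → ℝ), ∑ u : Fin t → ι, ∑ v : ι,
      ((∏ r, p (u r)) * (∑ r, g (u r)) ^ k) * (p v * G v) = qqvM p g k t * ∑ v, p v * G v := by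
    intro k t G
    unfold qqvM
    rw [Finset.sum_mul_sum]
  induction t with
  | zero => simp [qqvM]
  | succ t ih =>
    obtain ⟨h0, h1, h2, h4⟩ := ih
    have e0 := hsep 0 t (fun _ => 1)
    have e1a := hsep 0 t g
    have e1b := hsep 1 t (fun _ => 1)
    have e2a := hsep 0 t (fun v => g v ^ 2)
    have e2b := hsep 1 t g
    have e2c := hsep 2 t (fun _ => 1)
    have e4a := hsep 0 t (fun v => g v ^ 4)
    have e4b := hsep 1 t (fun v => g v ^ 3)
    have e4c := hsep 2 t (fun v => g v ^ 2)
    have e4d := hsep 3 t g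
    have e4e := hsep 4 t (fun _ => 1)
    simp only [mul_one, hp1, hg, h0, h1, h2, h4, mul_zero, zero_mul, one_mul] at e0 e1a e1b e2a e2b e2c e4a e4b e4c e4d e4e
    refine ⟨?_, ?_, ?_, ?_⟩
    · rw [hrec, ← e0]
      simp
    · rw [hrec, show (0:ℝ) = 0 + 0 by simp]
      nth_rewrite 1 [← e1a]
      rw [← e1b]
      simp only [← Finset.sum_add_distrib]
      refine Finset.sum_congr rfl fun u _ => Finset.sum_congr rfl fun v _ => ?_
      ring
    · have : qqvM p g 2 (t+1) = (∑ v, p v * g v ^ 2) + 2 * 0 + t * ∑ v, p v * g v ^ 2 := by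
        rw [hrec, ← e2c, ← e2a, ← e2b]
        simp only [← Finset.sum_add_distrib, Finset.mul_sum]
        refine Finset.sum_congr rfl fun u _ => Finset.sum_congr rfl fun v _ => ?_
        ring
      rw [this]; push_cast; ring
    · have : qqvM p g 4 (t+1) = (∑ v, p v * g v ^ 4) + 4 * 0
          + 6 * (t * (∑ v, p v * g v ^ 2) * ∑ v, p v * g v ^ 2) + 4 * 0
          + (3 * t * (t - 1) * (∑ v, p v * g v ^ 2) ^ 2 + t * ∑ v, p v * g v ^ 4) := by
        rw [hrec, ← e4c, ← e4e, ← e4a]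
        nth_rewrite 1 [← e4b]
        rw [← e4d]
        simp only [← Finset.sum_add_distrib, Finset.mul_sum]
        refine Finset.sum_congr rfl fun u _ => Finset.sum_congr rfl fun v _ => ?_
        ring
      rw [this]; push_cast; ring

lemma qqv_dev {ι : Type} [Fintype ι] (p g : ι → ℝ) (hp : ∀ v, 0 ≤ p v) (hp1 : ∑ v, p v = 1)
    (hg : ∑ v, p v * g v = 0) : ∃ K : ℝ, 0 ≤ K ∧ ∀ (ε : ℝ), 0 < ε → ∀ t : ℕ, 0 < t →
    ∑ u : Fin t → ι with ε * t ≤ |∑ r, g (u r)|, ∏ r, p (u r) ≤ K / ε ^ 4 * (1 / (t:ℝ) ^ 2) := by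
  refine ⟨3 * (∑ v, p v * g v ^ 2) ^ 2 + ∑ v, p v * g v ^ 4, ?_, ?_⟩
  · have : 0 ≤ ∑ v, p v * g v ^ 4 :=
      Finset.sum_nonneg fun v _ => mul_nonneg (hp v) (by positivity)
    positivity
  intro ε hε t ht
  have h4 := (qqv_M p g hp hp1 hg t).2.2.2
  have h4n : 0 ≤ ∑ v, p v * g v ^ 4 :=
    Finset.sum_nonneg fun v _ => mul_nonneg (hp v) (by positivity)
  have ht1 : (1:ℝ) ≤ t := by exact_mod_cast ht
  have hpn : ∀ u : Fin t → ι, 0 ≤ ∏ r, p (u r) := fun u => Finset.prod_nonneg fun r _ => hp _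
  have hb : (ε * t) ^ 4 * ∑ u : Fin t → ι with ε * t ≤ |∑ r, g (u r)|, ∏ r, p (u r)
      ≤ qqvM p g 4 t := by
    unfold qqvM
    rw [Finset.mul_sum]
    calc _ ≤ ∑ u : Fin t → ι with ε * t ≤ |∑ r, g (u r)|, (∏ r, p (u r)) * (∑ r, g (u r)) ^ 4 := by
          refine Finset.sum_le_sum fun u hu => ?_
          rw [mul_comm]
          refine mul_le_mul_of_nonneg_left ?_ (hpn u)
          rw [← Even.pow_abs (by decide : Even 4) (∑ r, g (u r))]
          exact pow_le_pow_left₀ (by positivity) (Finset.mem_filter.1 hu).2 4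
      _ ≤ _ := Finset.sum_le_sum_of_subset_of_nonneg (Finset.filter_subset _ _)
          fun u _ _ => mul_nonneg (hpn u) (by positivity)
  set A := (∑ v, p v * g v ^ 2) ^ 2 with hA
  have hAn : 0 ≤ A := by positivity
  set B := ∑ v, p v * g v ^ 4
  have h5 : qqvM p g 4 t ≤ (3 * A + B) * t ^ 2 := by
    rw [h4]
    nlinarith [mul_nonneg hAn (by positivity : (0:ℝ) ≤ t), mul_nonneg h4n (mul_nonneg (by positivity : (0:ℝ) ≤ t) (sub_nonneg.2 ht1))]
  have h6 := hb.trans h5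
  have h7 : (3 * A + B) / ε ^ 4 * (1 / (t:ℝ) ^ 2) = ((3 * A + B) * t ^ 2) / (ε * t) ^ 4 := by
    field_simp
  rw [h7, le_div_iff₀ (by positivity), mul_comm]
  exact h6

lemma qqv_path {E S Ω : Type} [AddCommGroup E] [MeasurableSpace Ω] (X : ℕ → Ω → E)
    (μ : Measure Ω) (q : E → S → ENNReal) (ξ : ℕ → E → S)
    (hM : ∀ t (xs : ℕ → E) (y : E), μ {ω | (∀ r ≤ t, X r ω = xs r) ∧ X (t + 1) ω = y}
        = q (y - xs t) (ξ t (xs t)) * μ {ω | ∀ r ≤ t, X r ω = xs r}) (xs : ℕ → E) (t : ℕ) :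
    μ {ω | ∀ r ≤ t, X r ω = xs r}
      = (∏ r ∈ Finset.range t, q (xs (r+1) - xs r) (ξ r (xs r))) * μ {ω | X 0 ω = xs 0} := by
  induction t with
  | zero => simp
  | succ t ih =>
    have : {ω | ∀ r ≤ t + 1, X r ω = xs r}
        = {ω | (∀ r ≤ t, X r ω = xs r) ∧ X (t + 1) ω = xs (t+1)} := by
      ext ω
      constructor
      · intro h
        exact ⟨fun r hr => h r (by omega), h _ le_rfl⟩
      · rintro ⟨h1, h2⟩ r hr
        rcases Nat.lt_or_ge r (t+1) with h | h
        · exact h1 r (by omega)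
        · obtain rfl : r = t + 1 := by omega
          exact h2
    rw [this, hM, ih, Finset.prod_range_succ]
    ring

/-- position of the walk with given steps -/
def qqvPos {E : Type} [AddCommGroup E] {U : Finset E} {t : ℕ} (x0 : E) (u : Fin t → U) (r : ℕ) : E :=
  x0 + ∑ k ∈ Finset.range r, (if h : k < t then (u ⟨k, h⟩ : E) else 0)

lemma qqv_null {E S Ω : Type} [AddCommGroup E] [Countable E] [MeasurableSpace Ω] (X : ℕ → Ω → E)
    (μ : Measure Ω) (q : E → S → ENNReal) (ξ : ℕ → E → S) (U : Finset E)
    (hq : ∀ u ∉ U, ∀ s, q u s = 0)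
    (hM : ∀ t (xs : ℕ → E) (y : E), μ {ω | (∀ r ≤ t, X r ω = xs r) ∧ X (t + 1) ω = y}
        = q (y - xs t) (ξ t (xs t)) * μ {ω | ∀ r ≤ t, X r ω = xs r}) :
    μ {ω | ∃ r, X (r+1) ω - X r ω ∉ U} = 0 := by
  classical
  let ext : (r : ℕ) → (Fin (r+1) → E) → ℕ → E := fun r v k => if h : k < r + 1 then v ⟨k, h⟩ else 0
  let B : (r : ℕ) → (Fin (r+1) → E) → E → Set Ω := fun r v y =>
    {ω | ((∀ k ≤ r, X k ω = ext r v k) ∧ X (r + 1) ω = y) ∧ y - ext r v r ∉ U}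
  have hsub : {ω | ∃ r, X (r+1) ω - X r ω ∉ U} ⊆ ⋃ r, ⋃ v, ⋃ y, B r v y := by
    rintro ω ⟨r, hr⟩
    simp only [Set.mem_iUnion]
    have hk : ∀ k ≤ r, X k ω = ext r (fun k => X k ω) k := by
      intro k hk
      simp only [ext]
      rw [dif_pos (Nat.lt_succ_of_le hk)]
    refine ⟨r, fun k => X k ω, X (r+1) ω, ⟨hk, rfl⟩, ?_⟩
    rw [← hk r le_rfl]
    exact hr
  refine measure_mono_null hsub ?_
  simp only [measure_iUnion_null_iff]
  intro r v y
  by_cases h : y - ext r v r ∈ U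
  · simp [B, h]
  · refine measure_mono_null (t := {ω | (∀ k ≤ r, X k ω = ext r v k) ∧ X (r + 1) ω = y})
      (fun ω hω => hω.1) ?_
    rw [hM, hq _ h, zero_mul]

lemma qqv_bad {E S Ω : Type} [AddCommGroup E] [Countable E] [MeasurableSpace Ω] (X : ℕ → Ω → E)
    (μ : Measure Ω) [IsProbabilityMeasure μ] (q : E → S → ENNReal) (ξ : ℕ → E → S) (U : Finset E)
    (hq : ∀ u ∉ U, ∀ s, q u s = 0)
    (hM : ∀ t (xs : ℕ → E) (y : E), μ {ω | (∀ r ≤ t, X r ω = xs r) ∧ X (t + 1) ω = y}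
        = q (y - xs t) (ξ t (xs t)) * μ {ω | ∀ r ≤ t, X r ω = xs r})
    (g : E → ℝ) (x0 : E) (t : ℕ) (a : ℝ) :
    μ {ω | X 0 ω = x0 ∧ a ≤ |∑ r ∈ Finset.range t, g (X (r+1) ω - X r ω)|}
      ≤ ∑ u : Fin t → U with a ≤ |∑ r, g (u r)|, ∏ r : Fin t, q (u r) (ξ r (qqvPos x0 u r)) := by
  classical
  let N := {ω | ∃ r, X (r+1) ω - X r ω ∉ U}
  let D : (Fin t → U) → Set Ω := fun u => {ω | ∀ r ≤ t, X r ω = qqvPos x0 u r}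
  have hD : ∀ u, μ (D u) ≤ ∏ r : Fin t, q (u r) (ξ r (qqvPos x0 u r)) := by
    intro u
    change μ {ω | ∀ r ≤ t, X r ω = qqvPos x0 u r} ≤ _
    rw [qqv_path X μ q ξ hM, Finset.prod_range]
    refine (mul_le_of_le_one_right (zero_le) prob_le_one).trans (le_of_eq ?_)
    refine Finset.prod_congr rfl fun r _ => ?_
    congr 1
    simp [qqvPos, Finset.sum_range_succ]
  have hsub : {ω | X 0 ω = x0 ∧ a ≤ |∑ r ∈ Finset.range t, g (X (r+1) ω - X r ω)|}
      ⊆ N ∪ ⋃ u ∈ Finset.univ.filter (fun u : Fin t → U => a ≤ |∑ r, g (u r)|), D u := by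
    rintro ω ⟨h0, ha⟩
    by_cases hN : ω ∈ N
    · exact Or.inl hN
    right
    have hU : ∀ r, X (r+1) ω - X r ω ∈ U := by
      intro r
      by_contra h
      exact hN ⟨r, h⟩
    simp only [Set.mem_iUnion]
    refine ⟨fun r => ⟨X (r+1) ω - X r ω, hU r⟩, ?_, ?_⟩
    · rw [Finset.mem_filter]
      refine ⟨Finset.mem_univ _, ?_⟩
      rw [Finset.sum_range] at ha
      exact ha
    · intro r hr
      have : ∑ k ∈ Finset.range r, (if h : k < t then X (k+1) ω - X k ω else 0)
          = ∑ k ∈ Finset.range r, (X (k+1) ω - X k ω) := by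
        refine Finset.sum_congr rfl fun k hk => ?_
        rw [dif_pos ((Finset.mem_range.1 hk).trans_le hr)]
      simp only [qqvPos]
      rw [this, Finset.sum_range_sub (fun k => X k ω), h0]
      abel
  calc _ ≤ μ N + μ (⋃ u ∈ Finset.univ.filter (fun u : Fin t → U => a ≤ |∑ r, g (u r)|), D u) :=
        (measure_mono hsub).trans (measure_union_le _ _)
    _ ≤ 0 + ∑ u : Fin t → U with a ≤ |∑ r, g (u r)|, μ (D u) := by
        gcongr
        · exact (qqv_null X μ q ξ U hq hM).le
        · exact measure_biUnion_finset_le _ _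
    _ ≤ _ := by
        rw [zero_add]
        exact Finset.sum_le_sum fun u _ => hD u

lemma qqv_key {E S Ω : Type} [AddCommGroup E] [Countable E] [Fintype S] [MeasurableSpace S]
    [MeasurableSpace Ω]
    (π : S → ℝ) (hπ0 : ∀ s, 0 ≤ π s) (hπ1 : ∑ s : S, π s = 1)
    (Penv : Measure (ℕ → E → S)) [IsProbabilityMeasure Penv]
    (hiid : ∀ (F : Finset (ℕ × E)) (f : ℕ × E → S),
      Penv {ξ | ∀ p ∈ F, ξ p.1 p.2 = f p} = ∏ p ∈ F, ENNReal.ofReal (π (f p)))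
    (X : ℕ → Ω → E) (P : (ℕ → E → S) → Measure Ω) (hP : ∀ ξ, IsProbabilityMeasure (P ξ))
    (q : E → S → ℝ) (hq0 : ∀ u s, 0 ≤ q u s) (U : Finset E)
    (hq : ∀ u ∉ U, ∀ s, q u s = 0)
    (hM : ∀ ξ t (xs : ℕ → E) (y : E), P ξ {ω | (∀ r ≤ t, X r ω = xs r) ∧ X (t + 1) ω = y}
        = ENNReal.ofReal (q (y - xs t) (ξ t (xs t))) * P ξ {ω | ∀ r ≤ t, X r ω = xs r})
    (p : E → ℝ) (hp : ∀ u, p u = ∑ s, q u s * π s) (hp1 : ∑ u ∈ U, p u = 1)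
    (g : E → ℝ) (hg : ∑ u ∈ U, p u * g u = 0) :
    ∀ᵐ ξ ∂Penv, ∀ᵐ ω ∂(P ξ), Tendsto (fun t : ℕ =>
      (∑ r ∈ Finset.range t, g (X (r+1) ω - X r ω)) / (t : ℝ)) atTop (𝓝 0) := by
  classical
  have hp0 : ∀ u, 0 ≤ p u := fun u => by
    rw [hp]; exact Finset.sum_nonneg fun s _ => mul_nonneg (hq0 u s) (hπ0 s)
  obtain ⟨K, hK0, hK⟩ := qqv_dev (fun u : U => p u) (fun u : U => g u) (fun u => hp0 u)
    (by rw [Finset.sum_coe_sort U p]; exact hp1)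
    (by rw [Finset.sum_coe_sort U (fun u => p u * g u)]; exact hg)
  let W : E → ℝ → ℕ → (ℕ → E → S) → ENNReal := fun x0 ε t ξ =>
    ∑ u : Fin t → U with ε * t ≤ |∑ r, g (u r)|,
      ∏ r : Fin t, ENNReal.ofReal (q (u r) (ξ r (qqvPos x0 u r)))
  have hWint : ∀ x0 ε t, AEMeasurable (W x0 ε t) Penv ∧ ∫⁻ ξ, W x0 ε t ξ ∂Penv
      = ENNReal.ofReal (∑ u : Fin t → U with ε * t ≤ |∑ r, g (u r)|, ∏ r, p (u r)) := by
    intro x0 ε t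
    have henv := fun u : Fin t → U => qqv_env π hπ0 hπ1 Penv hiid t (fun r => qqvPos x0 u r)
      (fun r s => ENNReal.ofReal (q (u r) s))
    refine ⟨Finset.aemeasurable_fun_sum _ fun u _ => (henv u).1, ?_⟩
    simp only [W]
    rw [lintegral_finsetSum' _ fun u _ => (henv u).1,
      ENNReal.ofReal_sum_of_nonneg fun u _ => Finset.prod_nonneg fun r _ => hp0 _]
    refine Finset.sum_congr rfl fun u _ => ?_
    rw [(henv u).2, ENNReal.ofReal_prod_of_nonneg fun r _ => hp0 _]
    refine Finset.prod_congr rfl fun r _ => ?_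
    rw [hp, ENNReal.ofReal_sum_of_nonneg fun s _ => mul_nonneg (hq0 _ s) (hπ0 s)]
    exact Finset.sum_congr rfl fun s _ => (ENNReal.ofReal_mul (hq0 _ s)).symm
  have hsum : ∀ x0, ∀ m : ℕ, ∀ᵐ ξ ∂Penv, ∑' t, W x0 (1 / ((m:ℝ) + 1)) (t+1) ξ ≠ ⊤ := by
    intro x0 m
    have hε : (0:ℝ) < 1 / ((m:ℝ) + 1) := by positivity
    have hae : AEMeasurable (fun ξ => ∑' t, W x0 (1 / ((m:ℝ) + 1)) (t+1) ξ) Penv :=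
      AEMeasurable.ennreal_tsum fun t => (hWint x0 _ (t+1)).1
    have : ∫⁻ ξ, ∑' t, W x0 (1 / ((m:ℝ) + 1)) (t+1) ξ ∂Penv ≠ ⊤ := by
      rw [lintegral_tsum fun t => (hWint x0 _ (t+1)).1]
      have hs : Summable fun t : ℕ => K / (1 / ((m:ℝ) + 1)) ^ 4 * (1 / ((t+1 : ℕ):ℝ) ^ 2) := by
        apply Summable.mul_left
        exact (summable_nat_add_iff 1).2 (Real.summable_one_div_nat_pow.2 (by norm_num : 1 < 2))
      refine ne_top_of_le_ne_top hs.tsum_ofReal_ne_top ?_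
      refine ENNReal.tsum_le_tsum fun t => ?_
      rw [(hWint x0 _ (t+1)).2]
      exact ENNReal.ofReal_le_ofReal (hK _ hε (t+1) (Nat.succ_pos t))
    filter_upwards [ae_lt_top' hae this] with ξ hξ using hξ.ne
  have hall : ∀ᵐ ξ ∂Penv, ∀ x0, ∀ m : ℕ, ∑' t, W x0 (1 / ((m:ℝ) + 1)) (t+1) ξ ≠ ⊤ :=
    ae_all_iff.2 fun x0 => ae_all_iff.2 fun m => hsum x0 m
  filter_upwards [hall] with ξ hξ
  have := hP ξ
  have hbc : ∀ᵐ ω ∂(P ξ), ∀ x0, ∀ m : ℕ, ∀ᶠ t : ℕ in atTop,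
      ¬ (X 0 ω = x0 ∧ 1 / ((m:ℝ) + 1) * (t+1 : ℕ)
        ≤ |∑ r ∈ Finset.range (t+1), g (X (r+1) ω - X r ω)|) := by
    refine ae_all_iff.2 fun x0 => ae_all_iff.2 fun m => ?_
    refine ae_eventually_notMem (s := fun t : ℕ => {ω | X 0 ω = x0 ∧ 1 / ((m:ℝ) + 1) * (t+1 : ℕ)
        ≤ |∑ r ∈ Finset.range (t+1), g (X (r+1) ω - X r ω)|}) ?_
    refine ne_top_of_le_ne_top (hξ x0 m) (ENNReal.tsum_le_tsum fun t => ?_)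
    exact qqv_bad X (P ξ) (fun u s => ENNReal.ofReal (q u s)) ξ U
      (fun u hu s => by simp [hq u hu s]) (hM ξ) g x0 (t+1) _
  filter_upwards [hbc] with ω hω
  rw [← tendsto_add_atTop_iff_nat 1, Metric.tendsto_nhds]
  intro ε hε
  obtain ⟨m, hm⟩ := exists_nat_one_div_lt hε
  filter_upwards [hω (X 0 ω) m] with t ht
  simp only [true_and, not_le] at ht
  have hpos : (0:ℝ) < ((t+1 : ℕ):ℝ) := by positivity
  rw [Real.dist_eq, sub_zero, abs_div, abs_of_pos hpos, div_lt_iff₀ hpos]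
  exact ht.trans (mul_lt_mul_of_pos_right hm hpos)

/-- For almost every environment `ξ`, `P_ξ`-almost surely the normalized quadratic
covariation matrix of `Y` converges: `(1/t)[Y]_t → η²` as `t → ∞`. -/
theorem quenched_quadratic_variation
    {n : ℕ} (hn : 1 ≤ n)
    {S : Type} [Fintype S] [MeasurableSpace S]
    (π : S → ℝ) (hπ0 : ∀ s, 0 ≤ π s) (hπ1 : ∑ s : S, π s = 1)
    {Ω : Type} [MeasurableSpace Ω]
    -- the random walk in random environment
    (X : ℕ → Ω → (Fin n → ℤ)) (hX : ∀ t, Measurable (X t))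
    -- the law of the i.i.d. environment, with marginals π
    (Penv : Measure (ℕ → (Fin n → ℤ) → S)) (hPenv : IsProbabilityMeasure Penv)
    (hiid : ∀ (F : Finset (ℕ × (Fin n → ℤ))) (f : ℕ × (Fin n → ℤ) → S),
      Penv {ξ | ∀ p ∈ F, ξ p.1 p.2 = f p} = ∏ p ∈ F, ENNReal.ofReal (π (f p)))
    -- the free transition kernel P₀ and the environment perturbation c
    (P₀ : (Fin n → ℤ) → ℝ) (c : (Fin n → ℤ) → S → ℝ)
    (hP₀fin : (Function.support P₀).Finite)
    (hcfin : ∀ s, (Function.support fun u => c u s).Finite)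
    (hP₀nonneg : ∀ u, 0 ≤ P₀ u) (hP₀sum : ∑ᶠ u : Fin n → ℤ, P₀ u = 1)
    (hrange : ∀ u s, 0 ≤ P₀ u + c u s ∧ P₀ u + c u s ≤ 1)
    (hcsum : ∀ s, ∑ᶠ u : Fin n → ℤ, c u s = 0)
    (hcπ : ∀ u, ∑ s : S, c u s * π s = 0)
    -- the drifts b^c, b⁰ and b = b⁰ + b^c
    (bc : Fin n → ℝ) (hbc : ∀ s i, ∑ᶠ u : Fin n → ℤ, (u i : ℝ) * c u s = bc i)
    (b : Fin n → ℝ) (hb : ∀ i, b i = (∑ᶠ u : Fin n → ℤ, (u i : ℝ) * P₀ u) + bc i)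
    -- the centered walk Y_t = X_t − t b
    (Y : ℕ → Ω → (Fin n → ℝ))
    (hY : ∀ t ω i, Y t ω i = (X t ω i : ℝ) - t * b i)
    -- the quenched laws P_ξ and the Markov property of the walk given the environment
    (P : (ℕ → (Fin n → ℤ) → S) → Measure Ω)
    (hP : ∀ ξ, IsProbabilityMeasure (P ξ))
    (hMarkov : ∀ ξ t (xs : ℕ → (Fin n → ℤ)) (y : Fin n → ℤ),
      P ξ {ω | (∀ r ≤ t, X r ω = xs r) ∧ X (t + 1) ω = y}
        = ENNReal.ofReal (P₀ (y - xs t) + c (y - xs t) (ξ t (xs t)))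
          * P ξ {ω | ∀ r ≤ t, X r ω = xs r})
 :
    ∀ᵐ ξ ∂Penv, ∀ᵐ ω ∂(P ξ), ∀ i j : Fin n,
      Tendsto (fun t : ℕ =>
          (∑ r ∈ Finset.range t,
            (Y (r + 1) ω i - Y r ω i) * (Y (r + 1) ω j - Y r ω j)) / (t : ℝ))
        atTop (𝓝 (etaSq π P₀ c b i j)) := by
  classical
  have hcπ' : ∀ u, ∑ s : S, π s * c u s = 0 := fun u => by
    rw [← hcπ u]; exact Finset.sum_congr rfl fun s _ => mul_comm _ _
  let U : Finset (Fin n → ℤ) :=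
    hP₀fin.toFinset ∪ Finset.univ.biUnion (fun s => (hcfin s).toFinset)
  have hUP : ∀ u ∉ U, P₀ u = 0 := by
    intro u hu
    by_contra h
    exact hu (Finset.mem_union_left _ (by simpa using h))
  have hUc : ∀ u ∉ U, ∀ s, c u s = 0 := by
    intro u hu s
    by_contra h
    exact hu (Finset.mem_union_right _ (Finset.mem_biUnion.2 ⟨s, Finset.mem_univ s, by simpa using h⟩))
  have hfs : ∀ F : (Fin n → ℤ) → ℝ, ∑ᶠ u, F u * P₀ u = ∑ u ∈ U, F u * P₀ u := by
    intro F
    apply finsum_eq_sum_of_support_subset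
    intro u hu
    by_contra h
    exact hu (by simp [hUP u h])
  have hp1 : ∑ u ∈ U, P₀ u = 1 := by
    have := hfs (fun _ => 1)
    simp only [one_mul] at this
    rw [← this, hP₀sum]
  have hmain : ∀ i j, ∀ᵐ ξ ∂Penv, ∀ᵐ ω ∂(P ξ), Tendsto (fun t : ℕ =>
          (∑ r ∈ Finset.range t,
            (Y (r + 1) ω i - Y r ω i) * (Y (r + 1) ω j - Y r ω j)) / (t : ℝ))
        atTop (𝓝 (etaSq π P₀ c b i j)) := by
    intro i j
    have heta : etaSq π P₀ c b i j
        = ∑ u ∈ U, ((u i : ℝ) - b i) * ((u j : ℝ) - b j) * P₀ u := by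
      rw [← hfs]
      unfold etaSq
      simp only [hcπ', add_zero]
    have key := qqv_key π hπ0 hπ1 Penv hiid X P hP (fun u s => P₀ u + c u s)
      (fun u s => (hrange u s).1) U (fun u hu s => by simp [hUP u hu, hUc u hu s]) hMarkov P₀
      (fun u => by simp only [add_mul, Finset.sum_add_distrib, hcπ u, ← Finset.mul_sum, hπ1]; ring)
      hp1 (fun u => ((u i : ℝ) - b i) * ((u j : ℝ) - b j) - etaSq π P₀ c b i j)
      (by
        simp only [mul_sub (P₀ _), Finset.sum_sub_distrib, ← Finset.sum_mul, hp1]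
        rw [heta, one_mul, sub_eq_zero]
        exact Finset.sum_congr rfl fun u _ => mul_comm _ _)
    filter_upwards [key] with ξ hξ
    filter_upwards [hξ] with ω hω
    have h2 := hω.add_const (etaSq π P₀ c b i j)
    rw [zero_add] at h2
    refine h2.congr' ?_
    filter_upwards [eventually_gt_atTop 0] with t ht
    have ht' : (t:ℝ) ≠ 0 := by positivity
    rw [Finset.sum_sub_distrib, Finset.sum_const, Finset.card_range, nsmul_eq_mul]
    field_simp
    rw [sub_add_cancel]
    refine Finset.sum_congr rfl fun r _ => ?_
    simp only [hY, Pi.sub_apply]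
    push_cast
    ring
  filter_upwards [ae_all_iff.2 fun i => ae_all_iff.2 fun j => hmain i j] with ξ h
  exact ae_all_iff.2 fun i => ae_all_iff.2 fun j => h i j
end
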